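/- Let p and q be distinct odd primes and let β : ZMod p → Aut(ZMod q) be a nontrivial group homomorphism. Let Γ be the (nonabelian) semidirect product (ZMod q) ⋊ (ZMod p) with respect to β. Then Γ admits no free continuous action on the 7-sphere: there is no continuous action of Γ by homeomorphisms on the unit sphere S⁷ = {x ∈ ℝ⁸ : ‖x‖ = 1} such that every g ∈ Γ with g ≠ 1 acts without fixed points. -/

import Mathlib

open Multiplicative

/-! ### Chains on lists -/

/-- Ordered integral chains of all dimensions on `X`: a list of length `n` is an
`(n - 1)`-simplex, and the empty list spans the augmentation degree. -/
abbrev ListChain (X : Type*) := List X →₀ ℤ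

namespace ListChain

open Finsupp

variable {X Y : Type*}

/-- The cone operator, putting a vertex in front of every simplex. -/
noncomputable def cone (x : X) : ListChain X →ₗ[ℤ] ListChain X :=
  Finsupp.lmapDomain ℤ ℤ (x :: ·)

/-- The alternating sum of the faces of a list. -/
noncomputable def listBoundary : List X → ListChain X
  | [] => 0
  | x :: l => single l 1 - cone x (listBoundary l)

/-- The augmented simplicial boundary. -/
noncomputable def boundary : ListChain X →ₗ[ℤ] ListChain X :=
  Finsupp.linearCombination ℤ listBoundary

/-- The chain map induced by a map of vertices. -/
noncomputable def push (f : X → Y) : ListChain X →ₗ[ℤ] ListChain Y :=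
  Finsupp.lmapDomain ℤ ℤ (List.map f)

/-- The prism between the images of a list under two maps. -/
noncomputable def listPrism (f g : X → Y) : List X → ListChain Y
  | [] => 0
  | x :: l => cone (f x) (cone (g x) (single (l.map g) 1)) - cone (f x) (listPrism f g l)

/-- The prism operator, a chain homotopy from `push f` to `push g`. -/
noncomputable def prism (f g : X → Y) : ListChain X →ₗ[ℤ] ListChain Y :=
  Finsupp.linearCombination ℤ (listPrism f g)

open Classical in
/-- The part of a chain carried by the simplices with all vertices in `A`. -/
noncomputable def restrictTo (A : Set X) : ListChain X →ₗ[ℤ] ListChain X :=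
  Finsupp.linearCombination ℤ fun l => if ∀ x ∈ l, x ∈ A then single l 1 else 0

@[simp] lemma cone_single (x : X) (l : List X) (a : ℤ) :
    cone x (single l a) = single (x :: l) a := by
  simp [cone, Finsupp.mapDomain_single]

@[simp] lemma boundary_single_nil : boundary (single ([] : List X) 1) = 0 := by
  simp [boundary, listBoundary]

lemma boundary_single_cons (x : X) (l : List X) :
    boundary (single (x :: l) 1) = single l 1 - cone x (boundary (single l 1)) := by
  simp [boundary, listBoundary]

@[simp] lemma push_single (f : X → Y) (l : List X) (a : ℤ) :
    push f (single l a) = single (l.map f) a := by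
  simp [push, Finsupp.mapDomain_single]

@[simp] lemma prism_single_nil (f g : X → Y) : prism f g (single [] 1) = 0 := by
  simp [prism, listPrism]

lemma prism_single_cons (f g : X → Y) (x : X) (l : List X) :
    prism f g (single (x :: l) 1) =
      cone (f x) (cone (g x) (push g (single l 1))) - cone (f x) (prism f g (single l 1)) := by
  simp [prism, listPrism]

lemma restrictTo_single_of_pos {A : Set X} {l : List X} (h : ∀ x ∈ l, x ∈ A) :
    restrictTo A (single l 1) = single l 1 := by
  rw [restrictTo, Finsupp.linearCombination_single, one_smul, if_pos h]

lemma restrictTo_single_of_neg {A : Set X} {l : List X} (h : ¬ ∀ x ∈ l, x ∈ A) :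
    restrictTo A (single l 1) = 0 := by
  rw [restrictTo, Finsupp.linearCombination_single, one_smul, if_neg h]

lemma lhom_ext_single {M : Type*} [AddCommGroup M] {S T : ListChain X →ₗ[ℤ] M}
    (h : ∀ l, S (single l 1) = T (single l 1)) : S = T :=
  Finsupp.lhom_ext' fun l => LinearMap.ext_ring (h l)

/-- Two linear maps that agree on the lists in `K` agree on the chains carried by `K`. -/
lemma eqOn_supported {M : Type*} [AddCommGroup M] {S T : ListChain X →ₗ[ℤ] M}
    {K : Set (List X)} (h : ∀ l ∈ K, S (single l 1) = T (single l 1))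
    {z : ListChain X} (hz : z ∈ Finsupp.supported ℤ ℤ K) : S z = T z := by
  rw [Finsupp.supported_eq_span_single] at hz
  refine LinearMap.eqOn_span (s := (fun l => single l (1 : ℤ)) '' K) ?_ hz
  rintro _ ⟨l, hl, rfl⟩
  exact h l hl

lemma map_mem_of_supported {M : Type*} [AddCommGroup M] {T : ListChain X →ₗ[ℤ] M}
    {K : Set (List X)} {N : Submodule ℤ M} (h : ∀ l ∈ K, T (single l 1) ∈ N)
    {z : ListChain X} (hz : z ∈ Finsupp.supported ℤ ℤ K) : T z ∈ N := by
  rw [Finsupp.supported_eq_span_single] at hz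
  have : Submodule.span ℤ ((fun l => single l (1 : ℤ)) '' K) ≤ N.comap T := by
    rw [Submodule.span_le]
    rintro _ ⟨l, hl, rfl⟩
    exact h l hl
  exact this hz

lemma boundary_cone (x : X) (z : ListChain X) :
    boundary (cone x z) = z - cone x (boundary z) := by
  have : boundary ∘ₗ cone x = LinearMap.id - cone x ∘ₗ boundary :=
    lhom_ext_single fun l => by simp [boundary_single_cons]
  exact LinearMap.congr_fun this z

lemma boundary_boundary (z : ListChain X) : boundary (boundary z) = 0 := by
  have : (boundary ∘ₗ boundary : ListChain X →ₗ[ℤ] ListChain X) = 0 := by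
    refine lhom_ext_single fun l => ?_
    induction l with
    | nil => simp
    | cons x l ih =>
      simp only [LinearMap.comp_apply, LinearMap.zero_apply] at ih ⊢
      simp [boundary_single_cons, boundary_cone, ih]
  exact LinearMap.congr_fun this z

lemma push_cone (f : X → Y) (x : X) (z : ListChain X) :
    push f (cone x z) = cone (f x) (push f z) := by
  have : push f ∘ₗ cone x = cone (f x) ∘ₗ push f := lhom_ext_single fun l => by simp
  exact LinearMap.congr_fun this z

lemma boundary_push (f : X → Y) (z : ListChain X) :
    boundary (push f z) = push f (boundary z) := by
  have : boundary ∘ₗ push f = push f ∘ₗ boundary := by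
    refine lhom_ext_single fun l => ?_
    induction l with
    | nil => simp
    | cons x l ih =>
      simp only [LinearMap.comp_apply, push_single] at ih
      simp [boundary_single_cons, push_cone, ih]
  exact LinearMap.congr_fun this z

lemma prism_cone (f g : X → Y) (x : X) (z : ListChain X) :
    prism f g (cone x z) = cone (f x) (cone (g x) (push g z)) - cone (f x) (prism f g z) := by
  have : prism f g ∘ₗ cone x =
      cone (f x) ∘ₗ cone (g x) ∘ₗ push g - cone (f x) ∘ₗ prism f g :=
    lhom_ext_single fun l => by simp [prism_single_cons]
  exact LinearMap.congr_fun this z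

lemma boundary_prism (f g : X → Y) (z : ListChain X) :
    boundary (prism f g z) = push g z - push f z - prism f g (boundary z) := by
  have : boundary ∘ₗ prism f g = push g - push f - prism f g ∘ₗ boundary := by
    refine lhom_ext_single fun l => ?_
    induction l with
    | nil => simp
    | cons x l ih =>
      simp only [LinearMap.comp_apply, LinearMap.sub_apply, push_single] at ih
      simp only [LinearMap.comp_apply, LinearMap.sub_apply, prism_single_cons, map_sub,
        boundary_cone, ih, boundary_single_cons, prism_cone, push_single, cone_single,
        List.map_cons]
      rw [← push_single, boundary_push]
      abel
  exact LinearMap.congr_fun this z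

lemma push_push {Z : Type*} (f : X → Y) (g : Y → Z) (z : ListChain X) :
    push g (push f z) = push (g ∘ f) z := by
  have : push g ∘ₗ push f = push (g ∘ f) := lhom_ext_single fun l => by simp
  exact LinearMap.congr_fun this z

lemma push_congr {f g : X → Y} {K : Set (List X)} (h : ∀ l ∈ K, ∀ x ∈ l, f x = g x)
    {z : ListChain X} (hz : z ∈ Finsupp.supported ℤ ℤ K) : push f z = push g z :=
  eqOn_supported (fun l hl => by simp [List.map_congr_left (h l hl)]) hz

lemma push_id (z : ListChain X) : push id z = z := by
  have : push (id : X → X) = LinearMap.id := lhom_ext_single fun l => by simp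
  exact LinearMap.congr_fun this z

/-! ### Small chains -/

/-- The lists of length `n` of pairwise `U`-close points of `A`. -/
def smallLists (A : Set X) (U : Set (X × X)) (n : ℕ) : Set (List X) :=
  {l | l.length = n ∧ (∀ x ∈ l, x ∈ A) ∧ ∀ x ∈ l, ∀ y ∈ l, (x, y) ∈ U}

/-- The chains carried by lists of length `n` of pairwise `U`-close points of `A`. -/
def small (A : Set X) (U : Set (X × X)) (n : ℕ) : Submodule ℤ (ListChain X) :=
  Finsupp.supported ℤ ℤ (smallLists A U n)

lemma single_mem_small {A : Set X} {U : Set (X × X)} {n : ℕ} {l : List X}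
    (h : l ∈ smallLists A U n) (a : ℤ) : single l a ∈ small A U n :=
  Finsupp.single_mem_supported ℤ a h

lemma smallLists_mono {A A' : Set X} {U U' : Set (X × X)} (hA : A ⊆ A') (hU : U ⊆ U') (n : ℕ) :
    smallLists A U n ⊆ smallLists A' U' n :=
  fun _ hl => ⟨hl.1, fun x hx => hA (hl.2.1 x hx), fun x hx y hy => hU (hl.2.2 x hx y hy)⟩

lemma small_mono {A A' : Set X} {U U' : Set (X × X)} (hA : A ⊆ A') (hU : U ⊆ U') (n : ℕ) :
    small A U n ≤ small A' U' n :=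
  Finsupp.supported_mono (smallLists_mono hA hU n)

lemma boundary_single_mem (l : List X) :
    boundary (single l 1) ∈
      Finsupp.supported ℤ ℤ {l' : List X | l'.Sublist l ∧ l'.length + 1 = l.length} := by
  induction l with
  | nil => simp
  | cons x l ih =>
    rw [boundary_single_cons]
    refine Submodule.sub_mem _ (Finsupp.single_mem_supported _ _ ?_) ?_
    · simp
    · refine map_mem_of_supported (fun l' hl' => ?_) ih
      rw [cone_single]
      exact Finsupp.single_mem_supported _ _ ⟨hl'.1.cons_cons x, by simp [hl'.2]⟩

lemma boundary_mem_small {A : Set X} {U : Set (X × X)} {n : ℕ} {z : ListChain X}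
    (hz : z ∈ small A U (n + 1)) : boundary z ∈ small A U n := by
  refine map_mem_of_supported (fun l hl => ?_) hz
  refine Finsupp.supported_mono ?_ (boundary_single_mem l)
  rintro l' ⟨hs, hlen⟩
  exact ⟨by have := hl.1; omega, fun x hx => hl.2.1 x (hs.subset hx),
    fun x hx y hy => hl.2.2 x (hs.subset hx) y (hs.subset hy)⟩

lemma push_mem_small {A : Set X} {A' : Set Y} {U : Set (X × X)} {U' : Set (Y × Y)} {f : X → Y}
    (hA : ∀ x ∈ A, f x ∈ A') (hU : ∀ x ∈ A, ∀ y ∈ A, (x, y) ∈ U → (f x, f y) ∈ U')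
    {n : ℕ} {z : ListChain X} (hz : z ∈ small A U n) : push f z ∈ small A' U' n := by
  refine map_mem_of_supported (fun l hl => ?_) hz
  rw [push_single]
  refine single_mem_small ⟨by simpa using hl.1, ?_, ?_⟩ 1
  · simpa using fun x hx => hA x (hl.2.1 x hx)
  · simpa using fun x hx y hy => hU x (hl.2.1 x hx) y (hl.2.1 y hy) (hl.2.2 x hx y hy)

lemma prism_single_mem (f g : X → Y) (l : List X) :
    prism f g (single l 1) ∈ Finsupp.supported ℤ ℤ
      {l' : List Y | l'.length = l.length + 1 ∧ ∀ y ∈ l', ∃ x ∈ l, y = f x ∨ y = g x} := by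
  induction l with
  | nil => simp
  | cons x l ih =>
    rw [prism_single_cons, push_single, cone_single, cone_single]
    refine Submodule.sub_mem _ (Finsupp.single_mem_supported _ _ ?_) ?_
    · refine ⟨by simp, fun y hy => ?_⟩
      simp only [List.mem_cons, List.mem_map] at hy
      rcases hy with rfl | rfl | ⟨a, ha, rfl⟩
      · exact ⟨x, by simp⟩
      · exact ⟨x, by simp⟩
      · exact ⟨a, by simp [ha]⟩
    · refine map_mem_of_supported (fun l' hl' => ?_) ih
      rw [cone_single]
      refine Finsupp.single_mem_supported _ _ ⟨by simp [hl'.1], fun y hy => ?_⟩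
      rcases List.mem_cons.1 hy with rfl | hy
      · exact ⟨x, by simp⟩
      · obtain ⟨a, ha, h⟩ := hl'.2 y hy
        exact ⟨a, by simp [ha], h⟩

lemma prism_mem_small {A : Set X} {A' : Set Y} {U : Set (X × X)} {U' : Set (Y × Y)} {f g : X → Y}
    (hf : ∀ x ∈ A, f x ∈ A') (hg : ∀ x ∈ A, g x ∈ A')
    (hU : ∀ x ∈ A, ∀ y ∈ A, (x, y) ∈ U →
      (f x, f y) ∈ U' ∧ (f x, g y) ∈ U' ∧ (g x, f y) ∈ U' ∧ (g x, g y) ∈ U')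
    {n : ℕ} {z : ListChain X} (hz : z ∈ small A U n) : prism f g z ∈ small A' U' (n + 1) := by
  refine map_mem_of_supported (fun l hl => ?_) hz
  refine Finsupp.supported_mono ?_ (prism_single_mem f g l)
  rintro l' ⟨hlen, hv⟩
  refine ⟨by rw [hlen, hl.1], fun y hy => ?_, fun y hy y' hy' => ?_⟩
  · obtain ⟨x, hx, rfl | rfl⟩ := hv y hy
    exacts [hf x (hl.2.1 x hx), hg x (hl.2.1 x hx)]
  · obtain ⟨x, hx, hxy⟩ := hv y hy
    obtain ⟨x', hx', hxy'⟩ := hv y' hy'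
    have := hU x (hl.2.1 x hx) x' (hl.2.1 x' hx') (hl.2.2 x hx x' hx')
    rcases hxy with rfl | rfl <;> rcases hxy' with rfl | rfl
    exacts [this.1, this.2.1, this.2.2.1, this.2.2.2]

lemma mem_small_inter {A B : Set X} {U : Set (X × X)} {n : ℕ} {z : ListChain X}
    (hA : z ∈ small A U n) (hB : z ∈ small B U n) : z ∈ small (A ∩ B) U n := by
  rw [small, Finsupp.mem_supported] at *
  intro l hl
  obtain ⟨h, hA, hU⟩ := hA hl
  exact ⟨h, fun x hx => ⟨hA x hx, (hB hl).2.1 x hx⟩, hU⟩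

lemma restrictTo_mem_small (A : Set X) {B : Set X} {U : Set (X × X)} {n : ℕ} {z : ListChain X}
    (hz : z ∈ small B U n) : restrictTo A z ∈ small (B ∩ A) U n := by
  refine map_mem_of_supported (fun l hl => ?_) hz
  by_cases h : ∀ x ∈ l, x ∈ A
  · rw [restrictTo_single_of_pos h]
    exact single_mem_small (A := B ∩ A) ⟨hl.1, fun x hx => ⟨hl.2.1 x hx, h x hx⟩, hl.2.2⟩ 1
  · rw [restrictTo_single_of_neg h]
    exact Submodule.zero_mem _

lemma restrictTo_eq_self {A B : Set X} (h : B ⊆ A) {U : Set (X × X)} {n : ℕ} {z : ListChain X}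
    (hz : z ∈ small B U n) : restrictTo A z = z :=
  eqOn_supported (T := LinearMap.id)
    (fun _ hl => restrictTo_single_of_pos fun x hx => h (hl.2.1 x hx)) hz

/-- The complement of `restrictTo A z` is carried by the lists with a vertex outside `A`. -/
lemma sub_restrictTo_mem {A B : Set X} {U : Set (X × X)} {n : ℕ} {z : ListChain X}
    (hz : z ∈ small B U n) :
    z - restrictTo A z ∈
      Finsupp.supported ℤ ℤ {l | l ∈ smallLists B U n ∧ ∃ x ∈ l, x ∉ A} := by
  refine map_mem_of_supported (T := LinearMap.id - restrictTo A) (fun l hl => ?_) hz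
  by_cases h : ∀ x ∈ l, x ∈ A
  · simp [restrictTo_single_of_pos h]
  · rw [LinearMap.sub_apply, restrictTo_single_of_neg h, sub_zero, LinearMap.id_apply]
    exact Finsupp.single_mem_supported _ _ ⟨hl, by push Not at h; exact h⟩

end ListChain

namespace ListChain

open Finsupp
open scoped Uniformity

/-! ### Homology of spheres at small scales -/

/-- Small cycles of `A` of length less than `m` bound small chains. -/
def AcyclicBelow {X : Type*} [UniformSpace X] (A : Set X) (m : ℕ) : Prop :=
  ∀ U ∈ 𝓤 X, ∃ V ∈ 𝓤 X, ∀ n < m, ∀ z ∈ small A V n, boundary z = 0 →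
    ∃ w ∈ small A U (n + 1), boundary w = z

/-- There is an integer-valued degree on the small cycles of length `m` that vanishes exactly on
the boundaries of small chains. -/
def HasDegree {X : Type*} [UniformSpace X] (A : Set X) (m : ℕ) : Prop :=
  ∃ U₀ ∈ 𝓤 X, ∃ D : ListChain X →ₗ[ℤ] ℤ, (∀ w ∈ small A U₀ (m + 1), D (boundary w) = 0) ∧
    ∀ U ∈ 𝓤 X, ∃ V ∈ 𝓤 X, ∀ z ∈ small A V m, boundary z = 0 → D z = 0 →
      ∃ w ∈ small A U (m + 1), boundary w = z

lemma small_zero_le {X : Type*} (A B : Set X) (U V : Set (X × X)) : small A U 0 ≤ small B V 0 := by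
  refine Finsupp.supported_mono fun l hl => ?_
  obtain rfl := List.length_eq_zero_iff.1 hl.1
  exact ⟨rfl, by simp, by simp⟩

section Retract

variable {X Y : Type*} [UniformSpace X] [UniformSpace Y] {A : Set X} {B : Set Y}
  {f : X → Y} {g : Y → X}

lemma exists_entourage_of_uniformContinuousOn {f : X → Y} {A : Set X}
    (hf : UniformContinuousOn f A) {V : Set (Y × Y)} (hV : V ∈ 𝓤 Y) :
    ∃ U ∈ 𝓤 X, ∀ x ∈ A, ∀ y ∈ A, (x, y) ∈ U → (f x, f y) ∈ V := by
  have := hf hV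
  rw [Filter.mem_map, Filter.mem_inf_principal] at this
  exact ⟨_, this, fun x hx y hy h => h ⟨hx, hy⟩⟩

lemma AcyclicBelow.of_retract {m : ℕ} (hB : AcyclicBelow B m)
    (hfA : ∀ x ∈ A, f x ∈ B) (hgB : ∀ y ∈ B, g y ∈ A) (hgf : ∀ x ∈ A, g (f x) = x)
    (hf : UniformContinuousOn f A) (hg : UniformContinuousOn g B) : AcyclicBelow A m := by
  intro U hU
  obtain ⟨U', hU', hgU⟩ := exists_entourage_of_uniformContinuousOn hg hU
  obtain ⟨V', hV', h⟩ := hB U' hU'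
  obtain ⟨V, hV, hfV⟩ := exists_entourage_of_uniformContinuousOn hf hV'
  refine ⟨V, hV, fun n hn z hz hz0 => ?_⟩
  obtain ⟨w, hw, hwz⟩ := h n hn (push f z) (push_mem_small hfA hfV hz)
    (by rw [boundary_push, hz0, map_zero])
  refine ⟨push g w, push_mem_small hgB hgU hw, ?_⟩
  rw [boundary_push, hwz, push_push,
    push_congr (f := g ∘ f) (g := id) (fun l hl x hx => hgf x (hl.2.1 x hx)) hz, push_id]

lemma HasDegree.of_retract {m : ℕ} (hB : HasDegree B m)
    (hfA : ∀ x ∈ A, f x ∈ B) (hgB : ∀ y ∈ B, g y ∈ A) (hgf : ∀ x ∈ A, g (f x) = x)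
    (hf : UniformContinuousOn f A) (hg : UniformContinuousOn g B) : HasDegree A m := by
  obtain ⟨U₀, hU₀, D, hD0, hD⟩ := hB
  obtain ⟨V₀, hV₀, hfV₀⟩ := exists_entourage_of_uniformContinuousOn hf hU₀
  refine ⟨V₀, hV₀, D ∘ₗ push f, fun w hw => ?_, fun U hU => ?_⟩
  · rw [LinearMap.comp_apply, ← boundary_push]
    exact hD0 _ (push_mem_small hfA hfV₀ hw)
  obtain ⟨U', hU', hgU⟩ := exists_entourage_of_uniformContinuousOn hg hU
  obtain ⟨V', hV', h⟩ := hD U' hU'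
  obtain ⟨V, hV, hfV⟩ := exists_entourage_of_uniformContinuousOn hf hV'
  refine ⟨V, hV, fun z hz hz0 hDz => ?_⟩
  obtain ⟨w, hw, hwz⟩ := h (push f z) (push_mem_small hfA hfV hz)
    (by rw [boundary_push, hz0, map_zero]) hDz
  refine ⟨push g w, push_mem_small hgB hgU hw, ?_⟩
  rw [boundary_push, hwz, push_push,
    push_congr (f := g ∘ f) (g := id) (fun l hl x hx => hgf x (hl.2.1 x hx)) hz, push_id]

end Retract

section Metric

/-- The pairs of points at distance less than `δ`. -/
def close (X : Type*) [PseudoMetricSpace X] (δ : ℝ) : Set (X × X) := {p | dist p.1 p.2 < δ}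

lemma close_mono {X : Type*} [PseudoMetricSpace X] {δ ε : ℝ} (h : δ ≤ ε) : close X δ ⊆ close X ε :=
  fun _ hp => lt_of_lt_of_le hp h

lemma close_mem_uniformity {X : Type*} [PseudoMetricSpace X] {δ : ℝ} (h : 0 < δ) :
    close X δ ∈ 𝓤 X := Metric.dist_mem_uniformity h

lemma exists_close_subset {X : Type*} [PseudoMetricSpace X] {U : Set (X × X)} (hU : U ∈ 𝓤 X) :
    ∃ δ > 0, close X δ ⊆ U := by
  obtain ⟨δ, hδ, h⟩ := Metric.mem_uniformity_dist.1 hU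
  exact ⟨δ, hδ, fun p hp => h hp⟩

/-- Small cycles of a bounded star-shaped set bound. -/
lemma exists_boundary_eq_of_starConvex {E : Type*} [SeminormedAddCommGroup E] [NormedSpace ℝ E]
    {S : Set E} {p : E} (hp : p ∈ S) (hS : StarConvex ℝ p S) {C : ℝ}
    (hC : ∀ x ∈ S, dist x p ≤ C) {ε : ℝ} (hε : 0 < ε) {n : ℕ} {z : ListChain E}
    (hz : z ∈ small S (close E (ε / 2)) n) (hz0 : boundary z = 0) :
    ∃ w ∈ small S (close E ε) (n + 1), boundary w = z := by
  have hC0 : 0 ≤ C := dist_nonneg.trans (hC p hp)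
  obtain ⟨N, hN⟩ := exists_nat_gt (C / (ε / 2))
  have hNpos : (0 : ℝ) < N := lt_of_le_of_lt (by positivity) hN
  have hCN : C / N < ε / 2 := by
    rw [div_lt_iff₀ (by positivity)] at hN ⊢
    linarith
  let f : ℕ → E → E := fun k x => AffineMap.lineMap x p ((k : ℝ) / N)
  have hfS : ∀ k ≤ N, ∀ x ∈ S, f k x ∈ S := by
    intro k hk x hx
    have h1 : (k : ℝ) / N ≤ 1 := by
      rw [div_le_one hNpos]
      exact_mod_cast hk
    have : f k x = ((k : ℝ) / N) • p + (1 - (k : ℝ) / N) • x := by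
      simp only [f, AffineMap.lineMap_apply_module]
      abel
    rw [this]
    exact hS hx (by positivity) (by linarith) (by ring)
  have hfd : ∀ k ≤ N, ∀ x y, dist (f k x) (f k y) ≤ dist x y := by
    intro k hk x y
    have h1 : (k : ℝ) / N ≤ 1 := by
      rw [div_le_one hNpos]
      exact_mod_cast hk
    have h0 : 0 ≤ (k : ℝ) / N := by positivity
    have : f k x - f k y = (1 - (k : ℝ) / N) • (x - y) := by
      simp only [f, AffineMap.lineMap_apply_module, smul_sub]
      abel
    rw [dist_eq_norm, this, norm_smul, Real.norm_eq_abs, abs_of_nonneg (by linarith),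
      dist_eq_norm]
    exact mul_le_of_le_one_left (norm_nonneg _) (by linarith)
  have hstep : ∀ k, ∀ x ∈ S, dist (f k x) (f (k + 1) x) < ε / 2 := by
    intro k x hx
    simp only [f]
    rw [dist_lineMap_lineMap, dist_comm, Real.dist_eq]
    have : ((k + 1 : ℕ) : ℝ) / N - (k : ℝ) / N = 1 / N := by
      push_cast
      ring
    rw [this, abs_of_pos (by positivity), one_div, inv_mul_eq_div]
    exact lt_of_le_of_lt (by gcongr; exact hC x hx) hCN
  have key : ∀ k ≤ N, ∃ w ∈ small S (close E ε) (n + 1), boundary w = push (f k) z - z := by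
    intro k
    induction k with
    | zero =>
      intro _
      refine ⟨0, Submodule.zero_mem _, ?_⟩
      have : f 0 = id := by
        funext x
        simp [f]
      rw [this, push_id, sub_self, map_zero]
    | succ k ih =>
      intro hk
      obtain ⟨w, hw, hwz⟩ := ih (by omega)
      refine ⟨w + prism (f k) (f (k + 1)) z, Submodule.add_mem _ hw ?_, ?_⟩
      · refine prism_mem_small (hfS k (by omega)) (hfS (k + 1) hk) ?_ hz
        intro x hx y hy hxy
        have hxy : dist x y < ε / 2 := hxy
        have h1 := hfd k (by omega) x y
        have h2 := hfd (k + 1) hk x y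
        have h3 := hstep k x hx
        have h4 := hstep k y hy
        have h5 := dist_triangle (f k x) (f k y) (f (k + 1) y)
        have h6 := dist_triangle (f (k + 1) x) (f k x) (f k y)
        rw [dist_comm (f (k + 1) x) (f k x)] at h6
        refine ⟨?_, ?_, ?_, ?_⟩ <;> change dist _ _ < ε <;> linarith
      · rw [map_add, hwz, boundary_prism, hz0, map_zero]
        abel
  obtain ⟨w, hw, hwz⟩ := key N le_rfl
  have hfN : ∀ x, f N x = p := fun x => by simp [f, div_self hNpos.ne']
  refine ⟨cone p (push (f N) z) - w, Submodule.sub_mem _ ?_ hw, ?_⟩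
  · refine map_mem_of_supported (T := cone p ∘ₗ push (f N)) (fun l hl => ?_) hz
    rw [LinearMap.comp_apply, push_single, cone_single]
    have hall : ∀ x ∈ p :: l.map (f N), x = p := by simp [hfN]
    refine single_mem_small ⟨by simpa using hl.1, fun x hx => ?_, fun x hx y hy => ?_⟩ 1
    · rwa [hall x hx]
    · rw [hall x hx, hall y hy]
      simpa [close] using hε
  · rw [map_sub, hwz, boundary_cone, boundary_push, hz0]
    simp

variable {X : Type*} [PseudoMetricSpace X] {F S : Set X} {ρ : X → X}

/-- The points of `A` at distance less than `δ` from `S`. -/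
def near (A S : Set X) (δ : ℝ) : Set X := {x ∈ A | ∃ y ∈ S, dist x y < δ}

lemma sub_restrictTo_mem_near {δ : ℝ} {n : ℕ} {z : ListChain X}
    (hz : z ∈ small (F ∪ S) (close X δ) n) :
    z - restrictTo F z ∈ small (near (F ∪ S) S δ) (close X δ) n := by
  refine Finsupp.supported_mono ?_ (sub_restrictTo_mem (A := F) hz)
  rintro l ⟨hl, y, hy, hyF⟩
  exact ⟨hl.1, fun x hx => ⟨hl.2.1 x hx, y, (hl.2.1 y hy).resolve_left hyF,
    hl.2.2 x hx y hy⟩, hl.2.2⟩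

lemma boundary_restrictTo_mem {δ : ℝ} {n : ℕ} {z : ListChain X}
    (hz : z ∈ small (F ∪ S) (close X δ) (n + 1)) (hz0 : boundary z = 0) :
    z - restrictTo F z ∈ small (near (F ∪ S) S δ) (close X δ) (n + 1) ∧
      boundary (restrictTo F z) ∈ small (near F S δ) (close X δ) n := by
  have h1 := sub_restrictTo_mem_near hz
  refine ⟨h1, ?_⟩
  have h2 := boundary_mem_small h1
  rw [map_sub, hz0, zero_sub, neg_mem_iff] at h2
  refine small_mono ?_ subset_rfl _
    (mem_small_inter h2 (boundary_mem_small (restrictTo_mem_small F hz)))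
  exact fun x hx => ⟨hx.2.2, hx.1.2⟩

lemma push_mem_small_inter (hρ : ∀ δ ≤ 1, ∀ x ∈ near F S δ, ρ x ∈ F ∩ S ∧ dist x (ρ x) < δ)
    {δ : ℝ} (hδ : δ ≤ 1) {n : ℕ} {y : ListChain X} (hy : y ∈ small (near F S δ) (close X δ) n) :
    push ρ y ∈ small (F ∩ S) (close X (3 * δ)) n := by
  refine push_mem_small (fun x hx => (hρ δ hδ x hx).1) (fun x hx y hy hxy => ?_) hy
  have h1 := (hρ δ hδ x hx).2
  have h2 := (hρ δ hδ y hy).2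
  have h3 : dist x y < δ := hxy
  have h4 := dist_triangle4 (ρ x) x y (ρ y)
  rw [dist_comm (ρ x) x] at h4
  change dist _ _ < _
  linarith

/-- A small cycle `z` of `F ∪ S` bounds as soon as the cycle of `F ∩ S` along which it is cut
does, when all small cycles of `F` and of `S` bound. -/
lemma exists_boundary_eq_of_union
    (hρ : ∀ δ ≤ 1, ∀ x ∈ near F S δ, ρ x ∈ F ∩ S ∧ dist x (ρ x) < δ)
    (hρS : ∀ x ∈ S, ρ x = x) {δ δ₁ ε : ℝ} (hδ0 : 0 < δ) (hδ1 : δ ≤ 1) (hδ : 5 * δ ≤ δ₁)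
    (hδε : 5 * δ ≤ ε) {n : ℕ}
    (hF : ∀ z ∈ small F (close X δ₁) (n + 1), boundary z = 0 →
      ∃ w ∈ small F (close X ε) (n + 2), boundary w = z)
    (hS : ∀ z ∈ small S (close X δ₁) (n + 1), boundary z = 0 →
      ∃ w ∈ small S (close X ε) (n + 2), boundary w = z)
    {z : ListChain X} (hz : z ∈ small (F ∪ S) (close X δ) (n + 1)) (hz0 : boundary z = 0)
    {w : ListChain X} (hw : w ∈ small (F ∩ S) (close X (3 * δ)) (n + 1))
    (hwz : boundary w = push ρ (boundary (restrictTo F z))) :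
    ∃ w ∈ small (F ∪ S) (close X ε) (n + 2), boundary w = z := by
  obtain ⟨hzS, hy⟩ := boundary_restrictTo_mem hz hz0
  set zF := restrictTo F z
  set y := boundary zF
  have hnearF : near F S δ ⊆ near (F ∪ S) S δ := fun x hx => ⟨Or.inl hx.1, hx.2⟩
  have hnearS : S ⊆ near (F ∪ S) S δ := fun x hx => ⟨Or.inr hx, x, hx, by simpa using hδ0⟩
  have hρ' : ∀ x ∈ near (F ∪ S) S δ, ρ x ∈ S ∧ dist x (ρ x) < δ := by
    rintro x ⟨hx | hx, h⟩
    · exact ⟨(hρ δ hδ1 x ⟨hx, h⟩).1.2, (hρ δ hδ1 x ⟨hx, h⟩).2⟩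
    · rw [hρS x hx]
      exact ⟨hx, by simpa using hδ0⟩
  have hh : prism id ρ y ∈ small (near F S δ) (close X (3 * δ)) (n + 1) := by
    refine prism_mem_small (fun x hx => hx) (fun x hx => ?_) (fun x hx x' hx' hxx => ?_) hy
    · have := (hρ δ hδ1 x hx).1
      exact ⟨this.1, _, this.2, by simpa using hδ0⟩
    · have h1 := (hρ δ hδ1 x hx).2
      have h2 := (hρ δ hδ1 x' hx').2
      have h3 : dist x x' < δ := hxx
      have h4 := dist_triangle4 (ρ x) x x' (ρ x')
      have h5 := dist_triangle (ρ x) x x'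
      have h6 := dist_triangle x x' (ρ x')
      rw [dist_comm (ρ x) x] at h4 h5
      refine ⟨?_, ?_, ?_, ?_⟩ <;> change dist _ _ < _ <;> simp only <;> linarith
  have hh0 : boundary (prism id ρ y) = push ρ y - y := by
    rw [boundary_prism, boundary_boundary, map_zero, push_id, sub_zero]
  have hzF : zF ∈ small F (close X δ) (n + 1) :=
    small_mono (fun x hx => hx.2) subset_rfl _ (restrictTo_mem_small F hz)
  obtain ⟨u, hu, hu0⟩ := hF (zF + prism id ρ y - w)
    (Submodule.sub_mem _ (Submodule.add_mem _
      (small_mono subset_rfl (close_mono (by linarith)) _ hzF)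
      (small_mono (fun x hx => hx.1) (close_mono (by linarith)) _ hh))
      (small_mono (fun x hx => hx.1) (close_mono (by linarith)) _ hw))
    (by rw [map_sub, map_add, hh0, hwz]; simp [y])
  set c := (z - zF) - prism id ρ y + w with hc
  have hcm : c ∈ small (near (F ∪ S) S δ) (close X (3 * δ)) (n + 1) :=
    Submodule.add_mem _ (Submodule.sub_mem _
      (small_mono subset_rfl (close_mono (by linarith)) _ hzS)
      (small_mono hnearF subset_rfl _ hh))
      (small_mono (fun x hx => hnearS hx.2) subset_rfl _ hw)
  have hc0 : boundary c = 0 := by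
    rw [hc, map_add, map_sub, map_sub, hh0, hwz, hz0]
    change 0 - y - _ + _ = 0
    abel
  obtain ⟨v, hv, hv0⟩ := hS (push ρ c)
    (push_mem_small (fun x hx => (hρ' x hx).1) (fun x hx y hy hxy => by
      have h1 := (hρ' x hx).2
      have h2 := (hρ' y hy).2
      have h3 : dist x y < 3 * δ := hxy
      have h4 := dist_triangle4 (ρ x) x y (ρ y)
      rw [dist_comm (ρ x) x] at h4
      change dist _ _ < _
      linarith) hcm)
    (by rw [boundary_push, hc0, map_zero])
  have hhc : prism id ρ c ∈ small (F ∪ S) (close X ε) (n + 2) := by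
    refine prism_mem_small (fun x hx => show id x ∈ F ∪ S from hx.1)
      (fun x hx => Or.inr (hρ' x hx).1) (fun x hx x' hx' hxx => ?_) hcm
    have h1 := (hρ' x hx).2
    have h2 := (hρ' x' hx').2
    have h3 : dist x x' < 3 * δ := hxx
    have h4 := dist_triangle4 (ρ x) x x' (ρ x')
    have h5 := dist_triangle (ρ x) x x'
    have h6 := dist_triangle x x' (ρ x')
    rw [dist_comm (ρ x) x] at h4 h5
    refine ⟨?_, ?_, ?_, ?_⟩ <;> change dist _ _ < _ <;> simp only [id] <;> linarith
  refine ⟨u + v - prism id ρ c, Submodule.sub_mem _ (Submodule.add_mem _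
    (small_mono Set.subset_union_left subset_rfl _ hu)
    (small_mono Set.subset_union_right subset_rfl _ hv)) hhc, ?_⟩
  rw [map_sub, map_add, hu0, hv0, boundary_prism, hc0, map_zero, push_id, hc]
  abel

/-- All small cycles of `A` bound small chains. -/
def Acyclic (A : Set X) : Prop :=
  ∀ ε > 0, ∃ δ > 0, ∀ n, ∀ z ∈ small A (close X δ) n, boundary z = 0 →
    ∃ w ∈ small A (close X ε) (n + 1), boundary w = z

lemma exists_gluing_scale (hF : Acyclic F) (hS : Acyclic S)
    (hρ : ∀ δ ≤ 1, ∀ x ∈ near F S δ, ρ x ∈ F ∩ S ∧ dist x (ρ x) < δ)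
    (hρS : ∀ x ∈ S, ρ x = x) {ε : ℝ} (hε : 0 < ε) :
    ∃ δ > 0, δ ≤ 1 ∧ ∀ n, ∀ z ∈ small (F ∪ S) (close X δ) (n + 1), boundary z = 0 →
      ∀ w ∈ small (F ∩ S) (close X (3 * δ)) (n + 1),
      boundary w = push ρ (boundary (restrictTo F z)) →
      ∃ w ∈ small (F ∪ S) (close X ε) (n + 2), boundary w = z := by
  obtain ⟨δF, hδF, hF⟩ := hF ε hε
  obtain ⟨δS, hδS, hS⟩ := hS ε hε
  set δ₁ := min δF δS
  have hδ₁ : 0 < δ₁ := lt_min hδF hδS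
  refine ⟨min 1 (min (δ₁ / 5) (ε / 5)), by positivity, min_le_left _ _, ?_⟩
  intro n z hz hz0 w hw hwz
  refine exists_boundary_eq_of_union hρ hρS (δ₁ := δ₁) (by positivity) (min_le_left _ _) ?_ ?_
    (fun z hz => hF _ z (small_mono subset_rfl (close_mono (min_le_left _ _)) _ hz))
    (fun z hz => hS _ z (small_mono subset_rfl (close_mono (min_le_right _ _)) _ hz))
    hz hz0 hw hwz
  · linarith [(min_le_right 1 (min (δ₁ / 5) (ε / 5))).trans (min_le_left _ _)]
  · linarith [(min_le_right 1 (min (δ₁ / 5) (ε / 5))).trans (min_le_right _ _)]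

lemma AcyclicBelow.union (hF : Acyclic F) (hS : Acyclic S)
    (hρ : ∀ δ ≤ 1, ∀ x ∈ near F S δ, ρ x ∈ F ∩ S ∧ dist x (ρ x) < δ)
    (hρS : ∀ x ∈ S, ρ x = x) {m : ℕ} (h : AcyclicBelow (F ∩ S) m) :
    AcyclicBelow (F ∪ S) (m + 1) := by
  intro U hU
  obtain ⟨ε, hε, hεU⟩ := exists_close_subset hU
  obtain ⟨δ₀, hδ₀, hδ₀1, hglue⟩ := exists_gluing_scale hF hS hρ hρS hε
  obtain ⟨V, hV, h⟩ := h _ (close_mem_uniformity (X := X) (δ := 3 * δ₀) (by positivity))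
  obtain ⟨δ', hδ', hδV⟩ := exists_close_subset hV
  obtain ⟨δS, hδS, hS⟩ := hS ε hε
  have hδpos : 0 < min δ₀ (δ' / 3) := by positivity
  refine ⟨close X (min δ₀ (δ' / 3)), close_mem_uniformity hδpos, ?_⟩
  rintro (_ | n) hn z hz hz0
  · obtain ⟨w, hw, hwz⟩ := hS 0 z (small_zero_le _ _ _ _ hz) hz0
    exact ⟨w, small_mono Set.subset_union_right hεU _ hw, hwz⟩
  · have hy := push_mem_small_inter hρ ((min_le_left _ _).trans hδ₀1)
      (boundary_restrictTo_mem hz hz0).2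
    obtain ⟨w, hw, hwz⟩ := h n (by omega) _ (small_mono subset_rfl
      ((close_mono (by linarith [min_le_right δ₀ (δ' / 3)])).trans hδV) _ hy)
      (by rw [boundary_push, boundary_boundary, map_zero])
    obtain ⟨v, hv, hvz⟩ := hglue n z
      (small_mono subset_rfl (close_mono (min_le_left _ _)) _ hz) hz0 w hw hwz
    exact ⟨v, small_mono subset_rfl hεU _ hv, hvz⟩

lemma HasDegree.union (hF : Acyclic F) (hS : Acyclic S)
    (hρ : ∀ δ ≤ 1, ∀ x ∈ near F S δ, ρ x ∈ F ∩ S ∧ dist x (ρ x) < δ)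
    (hρS : ∀ x ∈ S, ρ x = x) {m : ℕ} (h : HasDegree (F ∩ S) m) :
    HasDegree (F ∪ S) (m + 1) := by
  obtain ⟨U₀, hU₀, D, hD0, hD⟩ := h
  obtain ⟨ε₀, hε₀, hεU₀⟩ := exists_close_subset hU₀
  have hpos : 0 < min 1 (ε₀ / 3) := by positivity
  refine ⟨close X (min 1 (ε₀ / 3)), close_mem_uniformity hpos,
    D ∘ₗ push ρ ∘ₗ boundary ∘ₗ restrictTo F, fun w hw => ?_, fun U hU => ?_⟩
  · set wF := restrictTo F w
    have hwF : wF ∈ small F (close X (min 1 (ε₀ / 3))) (m + 2) :=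
      small_mono (fun x hx => hx.2) subset_rfl _ (restrictTo_mem_small F hw)
    have hwS : w - wF ∈ small (near (F ∪ S) S (min 1 (ε₀ / 3))) (close X (min 1 (ε₀ / 3)))
        (m + 2) := sub_restrictTo_mem_near hw
    set e := restrictTo F (boundary (w - wF)) with he
    have hem : e ∈ small (near F S (min 1 (ε₀ / 3))) (close X (min 1 (ε₀ / 3))) (m + 1) :=
      small_mono (A := near (F ∪ S) S _ ∩ F) (A' := near F S _)
        (fun x hx => ⟨hx.2, hx.1.2⟩) subset_rfl _
        (restrictTo_mem_small F (boundary_mem_small hwS))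
    have hsplit : restrictTo F (boundary w) = boundary wF + e := by
      rw [he, map_sub, map_sub, restrictTo_eq_self subset_rfl (boundary_mem_small hwF)]
      abel
    simp only [LinearMap.comp_apply]
    rw [hsplit, map_add, boundary_boundary, zero_add, ← boundary_push]
    refine hD0 _ (small_mono subset_rfl ((close_mono ?_).trans hεU₀) _
      (push_mem_small_inter hρ (min_le_left _ _) hem))
    linarith [min_le_right 1 (ε₀ / 3)]
  · obtain ⟨ε, hε, hεU⟩ := exists_close_subset hU
    obtain ⟨δ₀, hδ₀, hδ₀1, hglue⟩ := exists_gluing_scale hF hS hρ hρS hε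
    obtain ⟨V, hV, h⟩ := hD _ (close_mem_uniformity (X := X) (δ := 3 * δ₀) (by positivity))
    obtain ⟨δ', hδ', hδV⟩ := exists_close_subset hV
    have hδpos : 0 < min δ₀ (δ' / 3) := by positivity
    refine ⟨close X (min δ₀ (δ' / 3)), close_mem_uniformity hδpos, fun z hz hz0 hDz => ?_⟩
    have hy := push_mem_small_inter hρ ((min_le_left _ _).trans hδ₀1)
      (boundary_restrictTo_mem hz hz0).2
    obtain ⟨w, hw, hwz⟩ := h _ (small_mono subset_rfl
      ((close_mono (by linarith [min_le_right δ₀ (δ' / 3)])).trans hδV) _ hy)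
      (by rw [boundary_push, boundary_boundary, map_zero]) hDz
    obtain ⟨v, hv, hvz⟩ := hglue m z
      (small_mono subset_rfl (close_mono (min_le_left _ _)) _ hz) hz0 w hw hwz
    exact ⟨v, small_mono subset_rfl hεU _ hv, hvz⟩

end Metric

end ListChain

namespace ListChain

open Finsupp

/-! ### The boundary of the standard simplex -/

/-- The boundary of the standard `m`-simplex, a sphere of dimension `m - 1`. -/
def simplexBoundary (m : ℕ) : Set (Fin (m + 1) → ℝ) :=
  {x ∈ stdSimplex ℝ (Fin (m + 1)) | ∃ i, x i = 0}

/-- The face of the standard simplex opposite to the vertex `0`. -/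
def zeroFace (m : ℕ) : Set (Fin (m + 2) → ℝ) := {x ∈ stdSimplex ℝ (Fin (m + 2)) | x 0 = 0}

/-- The union of the faces of the standard simplex through the vertex `0`. -/
def zeroStar (m : ℕ) : Set (Fin (m + 2) → ℝ) :=
  {x ∈ stdSimplex ℝ (Fin (m + 2)) | ∃ i : Fin (m + 1), x i.succ = 0}

lemma zeroFace_union_zeroStar (m : ℕ) : zeroFace m ∪ zeroStar m = simplexBoundary (m + 1) := by
  ext x
  simp only [zeroFace, zeroStar, simplexBoundary, Set.mem_union, Set.mem_ofPred_eq,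
    Fin.exists_fin_succ (P := fun i => x i = 0)]
  tauto

lemma acyclic_of_starConvex {ι : Type*} [Fintype ι] {S : Set (ι → ℝ)} {p : ι → ℝ} (hp : p ∈ S)
    (hS : StarConvex ℝ p S) (hS1 : S ⊆ stdSimplex ℝ ι) : Acyclic S := by
  intro ε hε
  refine ⟨ε / 2, by positivity, fun n z hz hz0 =>
    exists_boundary_eq_of_starConvex hp hS (C := 1) (fun x hx => ?_) hε hz hz0⟩
  exact (dist_pi_le_iff zero_le_one).2 fun i => Real.dist_le_of_mem_Icc_01
    (mem_Icc_of_mem_stdSimplex (hS1 hx) i) (mem_Icc_of_mem_stdSimplex (hS1 hp) i)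

lemma acyclic_zeroFace (m : ℕ) : Acyclic (zeroFace m) := by
  refine acyclic_of_starConvex (p := Pi.single 1 1) ⟨single_mem_stdSimplex ℝ 1, by simp⟩
    (fun x hx a b ha hb hab => ⟨?_, by simp [hx.2]⟩) fun x hx => hx.1
  exact convex_stdSimplex ℝ _ (single_mem_stdSimplex ℝ 1) hx.1 ha hb hab

lemma acyclic_zeroStar (m : ℕ) : Acyclic (zeroStar m) := by
  refine acyclic_of_starConvex (p := Pi.single 0 1) ⟨single_mem_stdSimplex ℝ 0, 0, by simp⟩
    (fun x hx a b ha hb hab => ⟨?_, ?_⟩) fun x hx => hx.1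
  · exact convex_stdSimplex ℝ _ (single_mem_stdSimplex ℝ 0) hx.1 ha hb hab
  · obtain ⟨i, hi⟩ := hx.2
    exact ⟨i, by simp [hi]⟩

lemma exists_zeroFace_retraction (m : ℕ) : ∃ ρ : (Fin (m + 2) → ℝ) → Fin (m + 2) → ℝ,
    (∀ x ∈ zeroStar m, ρ x = x) ∧ ∀ δ ≤ 1, ∀ x ∈ near (zeroFace m) (zeroStar m) δ,
      ρ x ∈ zeroFace m ∩ zeroStar m ∧ dist x (ρ x) < δ := by
  have key : ∀ x : Fin (m + 2) → ℝ, ∃ e, (x ∈ zeroStar m → e = x) ∧ (x ∈ zeroFace m →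
      (∃ k : Fin (m + 1), x k.succ < 1) →
      e ∈ zeroFace m ∩ zeroStar m ∧ ∀ k : Fin (m + 1), dist x e ≤ x k.succ) := by
    intro x
    by_cases hxS : x ∈ zeroStar m
    · exact ⟨x, fun _ => rfl, fun hxF _ => ⟨⟨hxF, hxS⟩, fun k => by
        simpa using hxF.1.1 k.succ⟩⟩
    by_cases hxF : x ∈ zeroFace m ∧ ∃ k : Fin (m + 1), x k.succ < 1
    swap
    · exact ⟨x, fun _ => rfl, fun h1 h2 => absurd ⟨h1, h2⟩ hxF⟩
    obtain ⟨⟨⟨hx0, hx1⟩, hx⟩, k, hk⟩ := hxF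
    obtain ⟨i, hi⟩ := Finite.exists_min fun k : Fin (m + 1) => x k.succ
    obtain ⟨j, hj⟩ : ∃ j, j ≠ i := by
      by_contra! h
      rw [Fin.sum_univ_succ, hx, zero_add, Fintype.sum_eq_single i fun j hj => absurd (h j) hj]
        at hx1
      linarith [hi k]
    set a := x i.succ with ha
    have ha0 : 0 ≤ a := hx0 _
    have hji : j.succ ≠ i.succ := fun h => hj (Fin.succ_injective _ h)
    let e : Fin (m + 2) → ℝ := x - Pi.single i.succ a + Pi.single j.succ a
    have hei : e i.succ = 0 := by simp [e, hji.symm, ha]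
    have hej : e j.succ = x j.succ + a := by simp [e, hji]
    have hel : ∀ l, l ≠ i.succ → l ≠ j.succ → e l = x l := fun l h1 h2 => by simp [e, h1, h2]
    have he : e ∈ stdSimplex ℝ (Fin (m + 2)) := by
      refine ⟨fun l => ?_, ?_⟩
      · by_cases h1 : l = i.succ
        · rw [h1, hei]
        by_cases h2 : l = j.succ
        · rw [h2, hej]
          exact add_nonneg (hx0 _) ha0
        rw [hel l h1 h2]
        exact hx0 l
      · simp [e, Finset.sum_add_distrib, hx1]
    have hdist : dist x e ≤ a := by
      refine (dist_pi_le_iff ha0).2 fun l => ?_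
      by_cases h1 : l = i.succ
      · rw [h1, hei, Real.dist_eq, sub_zero, abs_of_nonneg (hx0 _)]
      by_cases h2 : l = j.succ
      · rw [h2, hej, Real.dist_eq, sub_add_cancel_left, abs_neg, abs_of_nonneg ha0]
      rw [hel l h1 h2, dist_self]
      exact ha0
    refine ⟨e, fun h => absurd h hxS, fun _ _ => ⟨⟨⟨he, ?_⟩, he, i, hei⟩, fun k =>
      hdist.trans (hi k)⟩⟩
    rw [hel 0 (Fin.succ_ne_zero i).symm (Fin.succ_ne_zero j).symm, hx]
  choose ρ hρS hρ using key
  refine ⟨ρ, hρS, fun δ hδ x hx => ?_⟩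
  obtain ⟨hxF, y, ⟨-, k, hk⟩, hxy⟩ := hx
  have hxk : x k.succ < δ := by
    have h1 := dist_le_pi_dist x y k.succ
    rw [hk, Real.dist_eq, sub_zero] at h1
    exact (le_abs_self _).trans_lt (h1.trans_lt hxy)
  obtain ⟨h1, h2⟩ := hρ x hxF ⟨k, hxk.trans_le hδ⟩
  exact ⟨h1, (h2 k).trans_lt hxk⟩

lemma acyclicBelow_and_hasDegree_simplexBoundary (m : ℕ) :
    AcyclicBelow (simplexBoundary m) m ∧ HasDegree (simplexBoundary m) m := by
  induction m with
  | zero =>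
    refine ⟨fun U hU => ⟨U, hU, fun n hn => absurd hn (Nat.not_lt_zero n)⟩,
      Set.univ, Filter.univ_mem, Finsupp.lapply [], fun w hw => ?_, fun U hU => ⟨U, hU, ?_⟩⟩
    · have : boundary w = 0 := by
        refine eqOn_supported (T := 0) (fun l hl => ?_) hw
        obtain ⟨x, rfl⟩ := List.length_eq_one_iff.1 hl.1
        obtain ⟨hx, i, hi⟩ := hl.2.1 x (by simp)
        rw [Subsingleton.elim (α := Fin 1) i 0] at hi
        exact absurd (hi.symm.trans ((Fin.sum_univ_one _).symm.trans hx.2)) zero_ne_one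
      rw [this, map_zero]
    · intro z hz _ hz0
      refine ⟨0, Submodule.zero_mem _, ?_⟩
      rw [map_zero]
      ext l
      by_cases h : l = []
      · rw [h]
        exact hz0.symm
      · exact (Finsupp.notMem_support_iff.1 fun hl =>
          h (List.length_eq_zero_iff.1 (hz hl).1)).symm
  | succ m ih =>
    obtain ⟨ρ, hρS, hρ⟩ := exists_zeroFace_retraction m
    have hf : UniformContinuousOn (fun (x : Fin (m + 2) → ℝ) (i : Fin (m + 1)) => x i.succ)
        (zeroFace m ∩ zeroStar m) :=
      (uniformContinuous_pi.2 fun i => Pi.uniformContinuous_proj _ i.succ).uniformContinuousOn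
    have hg : UniformContinuousOn
        (fun y : Fin (m + 1) → ℝ => (Fin.cons 0 y : Fin (m + 2) → ℝ)) (simplexBoundary m) := by
      refine (uniformContinuous_pi.2 fun i => ?_).uniformContinuousOn
      refine Fin.cases ?_ (fun i => ?_) i
      · simpa using uniformContinuous_const
      · simpa using Pi.uniformContinuous_proj _ i
    have hfA : ∀ x ∈ zeroFace m ∩ zeroStar m, (fun i : Fin (m + 1) => x i.succ) ∈
        simplexBoundary m := by
      rintro x ⟨⟨hx, hx0⟩, -, i, hi⟩
      refine ⟨⟨fun i => hx.1 _, ?_⟩, i, hi⟩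
      have := hx.2
      rwa [Fin.sum_univ_succ, hx0, zero_add] at this
    have hgB : ∀ y ∈ simplexBoundary m, (Fin.cons 0 y : Fin (m + 2) → ℝ) ∈
        zeroFace m ∩ zeroStar m := by
      rintro y ⟨hy, i, hi⟩
      have : (Fin.cons 0 y : Fin (m + 2) → ℝ) ∈ stdSimplex ℝ (Fin (m + 2)) := by
        constructor
        · intro k
          refine Fin.cases ?_ (fun k => ?_) k
          · simp
          · simpa using hy.1 k
        · rw [Fin.sum_univ_succ]
          simpa using hy.2
      exact ⟨⟨this, by simp⟩, this, i, by simpa using hi⟩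
    have hgf : ∀ x ∈ zeroFace m ∩ zeroStar m,
        (Fin.cons 0 (fun i : Fin (m + 1) => x i.succ) : Fin (m + 2) → ℝ) = x := by
      rintro x ⟨⟨-, hx0⟩, -⟩
      funext k
      refine Fin.cases ?_ (fun k => ?_) k
      · simp [hx0]
      · simp
    rw [← zeroFace_union_zeroStar]
    exact ⟨.union (acyclic_zeroFace m) (acyclic_zeroStar m) hρ hρS
        (ih.1.of_retract hfA hgB hgf hf hg),
      .union (acyclic_zeroFace m) (acyclic_zeroStar m) hρ hρS
        (ih.2.of_retract hfA hgB hgf hf hg)⟩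

end ListChain

namespace ListChain

open Finsupp

/-! ### The round sphere -/

section Sphere

variable {n : ℕ}

/-- The smallest of the coordinates of `(0, x)`. -/
noncomputable def minCoord (x : EuclideanSpace ℝ (Fin n)) : ℝ :=
  Finset.univ.inf' Finset.univ_nonempty fun i => (Fin.cons 0 (fun j => x j) : Fin (n + 1) → ℝ) i

/-- The barycentric coordinates, up to scaling, of the radial projection to the boundary of a
simplex. -/
noncomputable def shiftCoord (x : EuclideanSpace ℝ (Fin n)) (i : Fin (n + 1)) : ℝ :=
  (Fin.cons 0 (fun j => x j) : Fin (n + 1) → ℝ) i - minCoord x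

lemma continuous_cons_coord (i : Fin (n + 1)) : Continuous fun x : EuclideanSpace ℝ (Fin n) =>
    (Fin.cons 0 (fun j => x j) : Fin (n + 1) → ℝ) i := by
  refine Fin.cases ?_ (fun j => ?_) i
  · simpa using continuous_const
  · simp only [Fin.cons_succ]
    fun_prop

lemma continuous_shiftCoord (i : Fin (n + 1)) :
    Continuous fun x : EuclideanSpace ℝ (Fin n) => shiftCoord x i :=
  (continuous_cons_coord i).sub
    (Continuous.finset_inf'_apply _ fun i _ => continuous_cons_coord i)

lemma shiftCoord_nonneg (x : EuclideanSpace ℝ (Fin n)) (i : Fin (n + 1)) : 0 ≤ shiftCoord x i :=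
  sub_nonneg.2 (Finset.inf'_le _ (Finset.mem_univ i))

lemma exists_shiftCoord_eq_zero (x : EuclideanSpace ℝ (Fin n)) : ∃ i, shiftCoord x i = 0 := by
  obtain ⟨i, -, hi⟩ := Finset.exists_mem_eq_inf' Finset.univ_nonempty
    fun i => (Fin.cons 0 (fun j => x j) : Fin (n + 1) → ℝ) i
  exact ⟨i, sub_eq_zero.2 hi.symm⟩

lemma shiftCoord_succ_sub (x : EuclideanSpace ℝ (Fin n)) (j : Fin n) :
    shiftCoord x j.succ - shiftCoord x 0 = x j := by
  simp [shiftCoord]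

lemma sum_shiftCoord_pos {x : EuclideanSpace ℝ (Fin n)} (hx : x ≠ 0) :
    0 < ∑ i, shiftCoord x i := by
  refine lt_of_le_of_ne (Finset.sum_nonneg fun i _ => shiftCoord_nonneg x i) fun h => hx ?_
  have h0 := (Finset.sum_eq_zero_iff_of_nonneg fun i _ => shiftCoord_nonneg x i).1 h.symm
  ext j
  rw [← shiftCoord_succ_sub, h0 _ (Finset.mem_univ _), h0 _ (Finset.mem_univ _), sub_zero]
  rfl

/-- The map from the sphere to the boundary of the simplex. -/
noncomputable def toSimplexBoundary (x : EuclideanSpace ℝ (Fin n)) (i : Fin (n + 1)) : ℝ :=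
  shiftCoord x i / ∑ j, shiftCoord x j

/-- The linear map sending the boundary of the simplex to the boundary of a neighbourhood of
zero. -/
noncomputable def ofSimplex (y : Fin (n + 1) → ℝ) : EuclideanSpace ℝ (Fin n) :=
  WithLp.toLp 2 fun j => y j.succ - y 0

lemma continuous_ofSimplex : Continuous (ofSimplex (n := n)) := by
  unfold ofSimplex
  fun_prop

lemma ofSimplex_ne_zero {y : Fin (n + 1) → ℝ} (hy : y ∈ simplexBoundary n) : ofSimplex y ≠ 0 := by
  intro h
  have h1 : ∀ i, y i = y 0 := by
    refine Fin.cases rfl fun j => ?_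
    have := congrArg (fun z : EuclideanSpace ℝ (Fin n) => z j) h
    simpa [ofSimplex, sub_eq_zero] using this
  obtain ⟨⟨-, hy1⟩, i, hi⟩ := hy
  rw [h1] at hi
  simp [h1, hi] at hy1

lemma uniformContinuousOn_toSimplexBoundary : UniformContinuousOn (toSimplexBoundary (n := n))
    (Metric.sphere (0 : EuclideanSpace ℝ (Fin n)) 1) := by
  refine (isCompact_sphere _ _).uniformContinuousOn_of_continuous ?_
  refine continuousOn_pi.2 fun i => ContinuousOn.div (continuous_shiftCoord i).continuousOn
    (continuous_finsetSum _ fun i _ => continuous_shiftCoord i).continuousOn fun x hx => ?_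
  exact (sum_shiftCoord_pos (ne_zero_of_mem_unit_sphere ⟨x, hx⟩)).ne'

lemma uniformContinuousOn_normalize_ofSimplex :
    UniformContinuousOn (fun y => ‖ofSimplex y‖⁻¹ • ofSimplex (n := n) y)
      (simplexBoundary n) := by
  have hclosed : IsCompact (simplexBoundary n) := by
    refine (isCompact_stdSimplex ℝ (Fin (n + 1))).inter_right (t := {x | ∃ i, x i = 0}) ?_
    have : {x : Fin (n + 1) → ℝ | ∃ i, x i = 0} = ⋃ i, {x | x i = 0} := by
      ext
      simp
    rw [this]
    exact isClosed_iUnion_of_finite fun i => isClosed_eq (continuous_apply i) continuous_const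
  refine hclosed.uniformContinuousOn_of_continuous ?_
  exact ContinuousOn.smul (ContinuousOn.inv₀ continuous_ofSimplex.norm.continuousOn
    fun y hy => norm_ne_zero_iff.2 (ofSimplex_ne_zero hy)) continuous_ofSimplex.continuousOn

lemma toSimplexBoundary_mem {x : EuclideanSpace ℝ (Fin n)} (hx : x ≠ 0) :
    toSimplexBoundary x ∈ simplexBoundary n := by
  have hpos := sum_shiftCoord_pos hx
  refine ⟨⟨fun i => div_nonneg (shiftCoord_nonneg x i) hpos.le, ?_⟩, ?_⟩
  · simp only [toSimplexBoundary]
    rw [← Finset.sum_div, div_self hpos.ne']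
  · obtain ⟨i, hi⟩ := exists_shiftCoord_eq_zero x
    exact ⟨i, by simp [toSimplexBoundary, hi]⟩

lemma ofSimplex_toSimplexBoundary (x : EuclideanSpace ℝ (Fin n)) :
    ofSimplex (toSimplexBoundary x) = (∑ i, shiftCoord x i)⁻¹ • x := by
  ext j
  simp only [ofSimplex, toSimplexBoundary, PiLp.smul_apply, smul_eq_mul]
  rw [← sub_div, shiftCoord_succ_sub, inv_mul_eq_div]

lemma acyclicBelow_and_hasDegree_sphere {n : ℕ} (hn : n ≠ 0) :
    AcyclicBelow (Set.univ : Set (Metric.sphere (0 : EuclideanSpace ℝ (Fin n)) 1)) n ∧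
      HasDegree (Set.univ : Set (Metric.sphere (0 : EuclideanSpace ℝ (Fin n)) 1)) n := by
  have : NeZero n := ⟨hn⟩
  let x₀ : Metric.sphere (0 : EuclideanSpace ℝ (Fin n)) 1 :=
    ⟨EuclideanSpace.single 0 1, by simp⟩
  have hmem : ∀ y ∈ simplexBoundary n, ‖ofSimplex y‖⁻¹ • ofSimplex y ∈
      Metric.sphere (0 : EuclideanSpace ℝ (Fin n)) 1 := fun y hy => by
    rw [mem_sphere_zero_iff_norm, norm_smul, norm_inv, norm_norm,
      inv_mul_cancel₀ (norm_ne_zero_iff.2 (ofSimplex_ne_zero hy))]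
  classical
  let g : (Fin (n + 1) → ℝ) → Metric.sphere (0 : EuclideanSpace ℝ (Fin n)) 1 := fun y =>
    if hy : y ∈ simplexBoundary n then ⟨_, hmem y hy⟩ else x₀
  have hg : UniformContinuousOn g (simplexBoundary n) := by
    rw [uniformContinuousOn_iff_restrict]
    have := UniformContinuous.subtype_mk
      (uniformContinuousOn_iff_restrict.1 (uniformContinuousOn_normalize_ofSimplex (n := n)))
      fun y => hmem y.1 y.2
    refine this.congr fun y => ?_
    simp [g]
  have hf : UniformContinuousOn
      (fun x : Metric.sphere (0 : EuclideanSpace ℝ (Fin n)) 1 => toSimplexBoundary x.1)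
      Set.univ := by
    rw [uniformContinuousOn_univ]
    exact uniformContinuousOn_iff_restrict.1 uniformContinuousOn_toSimplexBoundary
  have hfA : ∀ x ∈ (Set.univ : Set (Metric.sphere (0 : EuclideanSpace ℝ (Fin n)) 1)),
      toSimplexBoundary x.1 ∈ simplexBoundary n := fun x _ =>
    toSimplexBoundary_mem (ne_zero_of_mem_unit_sphere x)
  have hgf : ∀ x ∈ (Set.univ : Set (Metric.sphere (0 : EuclideanSpace ℝ (Fin n)) 1)),
      g (toSimplexBoundary x.1) = x := by
    intro x hx
    have hpos := sum_shiftCoord_pos (ne_zero_of_mem_unit_sphere x)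
    ext1
    simp only [g, dif_pos (hfA x hx)]
    rw [ofSimplex_toSimplexBoundary, norm_smul, norm_eq_of_mem_sphere, mul_one, norm_inv,
      Real.norm_of_nonneg hpos.le, inv_inv, smul_smul, mul_inv_cancel₀ hpos.ne', one_smul]
  obtain ⟨h1, h2⟩ := acyclicBelow_and_hasDegree_simplexBoundary n
  exact ⟨h1.of_retract hfA (fun _ _ => Set.mem_univ _) hgf hf hg,
    h2.of_retract hfA (fun _ _ => Set.mem_univ _) hgf hf hg⟩

end Sphere

end ListChain

namespace ListChain

open Finsupp
open scoped Uniformity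

/-! ### Periodic resolutions realised by chains -/

section Action

variable {G X : Type*} [Group G] [MulAction G X]

/-- The action of a group on the chains. -/
noncomputable def act : G →* Module.End ℤ (ListChain X) where
  toFun γ := push (γ • ·)
  map_one' := by
    refine lhom_ext_single fun l => ?_
    simp
  map_mul' a b := by
    refine lhom_ext_single fun l => ?_
    simp [Module.End.mul_apply, mul_smul, Function.comp_def]

lemma act_apply (γ : G) (z : ListChain X) : act γ z = push (γ • ·) z := rfl

lemma boundary_act (γ : G) (z : ListChain X) : boundary (act γ z) = act γ (boundary z) :=
  boundary_push _ z

lemma act_single_nil (γ : G) : act γ (single ([] : List X) 1) = single [] 1 := by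
  simp [act_apply]

variable (G) in
/-- A relation preserved by the action. -/
def IsInvariant (U : Set (X × X)) : Prop := ∀ (γ : G) (x y : X), (x, y) ∈ U → (γ • x, γ • y) ∈ U

lemma act_mem_small {U : Set (X × X)} (hU : IsInvariant G U) {A : Set X} {γ : G}
    (hA : ∀ x ∈ A, γ • x ∈ A) {n : ℕ} {z : ListChain X} (hz : z ∈ small A U n) :
    act γ z ∈ small A U n :=
  push_mem_small hA (fun x _ y _ => hU γ x y) hz

lemma exists_isInvariant_subset [Finite G] [UniformSpace X]
    (hc : ∀ γ : G, UniformContinuous fun x : X => γ • x) {U : Set (X × X)} (hU : U ∈ 𝓤 X) :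
    ∃ V ∈ 𝓤 X, V ⊆ U ∧ IsInvariant G V := by
  refine ⟨⋂ γ : G, (fun p : X × X => (γ • p.1, γ • p.2)) ⁻¹' U,
    Filter.iInter_mem.2 fun γ => hc γ hU, fun p hp => ?_, fun γ x y h => ?_⟩
  · simpa using Set.mem_iInter.1 hp 1
  · refine Set.mem_iInter.2 fun δ => ?_
    have := Set.mem_iInter.1 h (δ * γ)
    simpa [mul_smul] using this

/-- The norm operator of an element of order dividing `q`. -/
noncomputable def normOp (g : G) (q : ℕ) : Module.End ℤ (ListChain X) :=
  ∑ i ∈ Finset.range q, act g ^ i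

/-- The differentials of the periodic resolution of the cyclic group of order `q`. -/
noncomputable def stepOp (g : G) (q : ℕ) (i : ℕ) : Module.End ℤ (ListChain X) :=
  if Even i then act g - 1 else normOp g q

lemma act_pow_eq_one {g : G} {q : ℕ} (hg : g ^ q = 1) :
    (act g : Module.End ℤ (ListChain X)) ^ q = 1 := by
  rw [← map_pow, hg, map_one]

lemma stepOp_succ_mul {g : G} {q : ℕ} (hg : g ^ q = 1) (i : ℕ) :
    (stepOp g q (i + 1) : Module.End ℤ (ListChain X)) * stepOp g q i = 0 := by
  rcases Nat.even_or_odd i with hi | hi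
  · rw [stepOp, stepOp, if_neg (by simpa [Nat.even_add_one] using hi), if_pos hi, normOp,
      geom_sum_mul, act_pow_eq_one hg, sub_self]
  · rw [stepOp, stepOp, if_pos hi.add_one, if_neg (by simpa using hi), normOp,
      mul_geom_sum, act_pow_eq_one hg, sub_self]

lemma boundary_normOp (g : G) (q : ℕ) (z : ListChain X) :
    boundary (normOp g q z) = normOp g q (boundary z) := by
  simp only [normOp, LinearMap.sum_apply, map_sum, ← map_pow, boundary_act]

lemma boundary_stepOp (g : G) (q i : ℕ) (z : ListChain X) :
    boundary (stepOp g q i z) = stepOp g q i (boundary z) := by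
  unfold stepOp
  split_ifs
  · simp [boundary_act]
  · exact boundary_normOp g q z

lemma act_pow_mem_small {U : Set (X × X)} (hU : IsInvariant G U) {A : Set X} {g : G}
    (hA : ∀ x ∈ A, g • x ∈ A) (i : ℕ) {n : ℕ} {z : ListChain X}
    (hz : z ∈ small A U n) : act (g ^ i) z ∈ small A U n := by
  induction i with
  | zero => simpa using hz
  | succ i ih =>
    rw [pow_succ', map_mul]
    exact act_mem_small hU hA ih

lemma normOp_mem_small {U : Set (X × X)} (hU : IsInvariant G U) {A : Set X} {g : G}
    (hA : ∀ x ∈ A, g • x ∈ A) (q : ℕ) {n : ℕ} {z : ListChain X}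
    (hz : z ∈ small A U n) : normOp g q z ∈ small A U n := by
  rw [normOp, LinearMap.sum_apply]
  refine Submodule.sum_mem _ fun i _ => ?_
  rw [← map_pow]
  exact act_pow_mem_small hU hA i hz

lemma stepOp_mem_small {U : Set (X × X)} (hU : IsInvariant G U) {A : Set X} {g : G}
    (hA : ∀ x ∈ A, g • x ∈ A) (q i : ℕ) {n : ℕ} {z : ListChain X}
    (hz : z ∈ small A U n) : stepOp g q i z ∈ small A U n := by
  unfold stepOp
  split_ifs
  · exact Submodule.sub_mem _ (act_mem_small hU hA hz) hz
  · exact normOp_mem_small hU hA q hz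

/-- Compatible chains `c 0, …, c n`, where `c i` has length `i + 1`, forming the beginning of a
map from the periodic resolution to the small chains of `A`. -/
structure IsResolution (A : Set X) (U : Set (X × X)) (g : G) (q n : ℕ) (c : ℕ → ListChain X) :
    Prop where
  mem : ∀ i ≤ n, c i ∈ small A U (i + 1)
  boundary_succ : ∀ i < n, boundary (c (i + 1)) = stepOp g q i (c i)

variable [UniformSpace X]

lemma exists_isInvariant_bounding [Finite G] (hc : ∀ γ : G, UniformContinuous fun x : X => γ • x)
    {m : ℕ} (hA : AcyclicBelow (Set.univ : Set X) m) {U : Set (X × X)} (hU : U ∈ 𝓤 X) :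
    ∃ V ∈ 𝓤 X, V ⊆ U ∧ IsInvariant G V ∧ ∀ n < m, ∀ z ∈ small Set.univ V n, boundary z = 0 →
      ∃ w ∈ small Set.univ U (n + 1), boundary w = z := by
  obtain ⟨V, hV, h⟩ := hA U hU
  obtain ⟨W, hW, hWV, hWi⟩ := exists_isInvariant_subset hc (Filter.inter_mem hU hV)
  exact ⟨W, hW, fun p hp => (hWV hp).1, hWi, fun n hn z hz hz0 =>
    h n hn z (small_mono subset_rfl (fun p hp => (hWV hp).2) _ hz) hz0⟩

lemma exists_isResolution [Finite G] (hc : ∀ γ : G, UniformContinuous fun x : X => γ • x)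
    {m : ℕ} (hA : AcyclicBelow (Set.univ : Set X) m) {g : G} {q : ℕ} (hg : g ^ q = 1) (n : ℕ)
    (hn : n < m) {U : Set (X × X)} (hU : U ∈ 𝓤 X) :
    ∃ c, IsResolution Set.univ U g q n c ∧ boundary (c 0) = single [] 1 := by
  induction n generalizing U with
  | zero =>
    obtain ⟨V, hV, h⟩ := hA U hU
    obtain ⟨w, hw, hw0⟩ := h 0 hn (single [] 1) (single_mem_small ⟨rfl, by simp, by simp⟩ 1)
      boundary_single_nil
    exact ⟨fun _ => w, ⟨fun i hi => by rwa [Nat.le_zero.1 hi],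
      fun i hi => absurd hi (Nat.not_lt_zero i)⟩, hw0⟩
  | succ n ih =>
    obtain ⟨V, hV, hVU, hVi, h⟩ := exists_isInvariant_bounding (G := G) hc hA hU
    obtain ⟨c, hcr, hc0⟩ := ih (by omega) hV
    have hcyc : boundary (stepOp g q n (c n)) = 0 := by
      rw [boundary_stepOp]
      cases n with
      | zero => simp [hc0, stepOp, act_single_nil]
      | succ n =>
        rw [hcr.boundary_succ n (by omega), ← Module.End.mul_apply, stepOp_succ_mul hg]
        rfl
    obtain ⟨w, hw, hw0⟩ := h (n + 1) hn _
      (stepOp_mem_small hVi (fun _ _ => Set.mem_univ _) q n (hcr.mem n le_rfl)) hcyc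
    refine ⟨Function.update c (n + 1) w, ⟨fun i hi => ?_, fun i hi => ?_⟩, ?_⟩
    · rcases eq_or_ne i (n + 1) with rfl | hne
      · simpa using hw
      · rw [Function.update_of_ne hne]
        exact small_mono subset_rfl hVU _ (hcr.mem i (by omega))
    · rw [Function.update_of_ne (show i ≠ n + 1 by omega)]
      rcases eq_or_ne i n with rfl | hne
      · simpa using hw0
      · rw [Function.update_of_ne (by omega)]
        exact hcr.boundary_succ i (by omega)
    · rw [Function.update_of_ne (by omega), hc0]

/-- Uniqueness of resolutions up to homotopy. -/
lemma exists_cycle_of_isResolution [Finite G]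
    (hc : ∀ γ : G, UniformContinuous fun x : X => γ • x)
    {m : ℕ} (hA : AcyclicBelow (Set.univ : Set X) m) {g : G} {q : ℕ} (hg : g ^ q = 1) (n : ℕ)
    (hn : n < m) {U : Set (X × X)} (hU : U ∈ 𝓤 X) :
    ∃ V ∈ 𝓤 X, V ⊆ U ∧ ∀ d, IsResolution Set.univ V g q n d → boundary (d 0) = 0 →
      ∃ y ∈ small Set.univ U (n + 1), boundary y = 0 ∧
        stepOp g q n (d n) = stepOp g q n y := by
  induction n generalizing U with
  | zero => exact ⟨U, hU, subset_rfl, fun d hd hd0 => ⟨d 0, hd.mem 0 le_rfl, hd0, rfl⟩⟩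
  | succ n ih =>
    obtain ⟨U', hU', hUU', hUi'⟩ := exists_isInvariant_subset hc hU
    obtain ⟨V, hV, hVU, hVi, h⟩ := exists_isInvariant_bounding (G := G) hc hA hU'
    obtain ⟨W, hW, hWV, h'⟩ := ih (by omega) hV
    refine ⟨W, hW, hWV.trans (hVU.trans hUU'), fun d hd hd0 => ?_⟩
    obtain ⟨y, hy, hy0, hyd⟩ := h' d ⟨fun i hi => hd.mem i (by omega),
      fun i hi => hd.boundary_succ i (by omega)⟩ hd0
    obtain ⟨e, he, hey⟩ := h (n + 1) hn y hy hy0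
    refine ⟨d (n + 1) - stepOp g q n e, Submodule.sub_mem _
      (small_mono subset_rfl (hWV.trans (hVU.trans hUU')) _ (hd.mem _ le_rfl))
      (small_mono subset_rfl hUU' _
        (stepOp_mem_small hUi' (fun _ _ => Set.mem_univ _) q n he)), ?_, ?_⟩
    · rw [map_sub, boundary_stepOp, hey, hd.boundary_succ n (by omega), hyd, sub_self]
    · rw [map_sub, ← Module.End.mul_apply, stepOp_succ_mul hg, LinearMap.zero_apply, sub_zero]

end Action

end ListChain

namespace ListChain

open Finsupp
open scoped Uniformity

/-! ### Vanishing of the obstruction -/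

section Action

variable {G X : Type*} [Group G] [MulAction G X]

lemma act_act (a b : G) (z : ListChain X) : act a (act b z) = act (a * b) z := by
  rw [map_mul, Module.End.mul_apply]

/-- Elements of odd order preserve the degree. -/
lemma degree_act_eq {D : ListChain X →ₗ[ℤ] ℤ} {Z : Submodule ℤ (ListChain X)}
    (hZ : ∀ (γ : G), ∀ z ∈ Z, act γ z ∈ Z)
    (hD : ∀ (γ : G), ∀ z ∈ Z, D z = 0 → D (act γ z) = 0) {γ : G} {k : ℕ} (hk : Odd k)
    (hγ : γ ^ k = 1) {z : ListChain X} (hz : z ∈ Z) : D (act γ z) = D z := by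
  by_cases h0 : D z = 0
  · rw [hD γ z hz h0, h0]
  have cross : ∀ z' ∈ Z, D z * D (act γ z') = D z' * D (act γ z) := by
    intro z' hz'
    have := hD γ (D z • z' - D z' • z) (Submodule.sub_mem _ (Submodule.smul_mem _ _ hz')
      (Submodule.smul_mem _ _ hz)) (by simp [mul_comm])
    simpa [sub_eq_zero] using this
  have hpow : ∀ i, D z ^ i * D (act (γ ^ i) z) = D (act γ z) ^ i * D z := by
    intro i
    induction i with
    | zero => simp
    | succ i ih =>
      have h1 := cross (act (γ ^ i) z) (hZ _ z hz)
      rw [act_act, ← pow_succ'] at h1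
      rw [pow_succ, mul_assoc, h1, ← mul_assoc, ih]
      ring
  have h1 := hpow k
  rw [hγ, map_one, Module.End.one_apply] at h1
  exact (hk.strictMono_pow.injective (mul_right_cancel₀ h0 h1)).symm

lemma normOp_pow {g : G} {q r : ℕ} [NeZero q] (hg : g ^ q = 1) (hr : r.Coprime q) :
    (normOp (g ^ r) q : Module.End ℤ (ListChain X)) = normOp g q := by
  have key : ∀ s : ℕ, normOp (g ^ s) q =
      ∑ x : ZMod q, (act g : Module.End ℤ (ListChain X)) ^ ((s : ZMod q) * x).val := by
    intro s
    refine Finset.sum_nbij' (fun i => (i : ZMod q)) ZMod.val (by simp)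
      (fun x _ => Finset.mem_range.2 x.val_lt) (fun i hi => ?_) (by simp) fun i _ => ?_
    · exact ZMod.val_cast_of_lt (Finset.mem_range.1 hi)
    · rw [map_pow, ← pow_mul, pow_eq_pow_mod _ (act_pow_eq_one hg), ← ZMod.val_natCast]
      push_cast
      rfl
  have h1 := key 1
  rw [pow_one] at h1
  rw [h1, key]
  refine Fintype.sum_equiv (Units.mulLeft (ZMod.unitOfCoprime r hr)) _ _ fun x => ?_
  simp

lemma act_mul_normOp {g h : G} {q r : ℕ} [NeZero q] (hg : g ^ q = 1) (hr : r.Coprime q)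
    (hgh : h * g = g ^ r * h) :
    (act h : Module.End ℤ (ListChain X)) * normOp g q = normOp g q * act h := by
  have hs : SemiconjBy h g (g ^ r) := hgh
  conv_rhs => rw [← normOp_pow hg hr]
  simp only [normOp, Finset.mul_sum, Finset.sum_mul]
  refine Finset.sum_congr rfl fun i _ => ?_
  rw [← map_pow, ← map_pow, ← map_mul, ← map_mul, (hs.pow_right i).eq]

/-- The comparison sequence: transporting a resolution `c` for `g` to one for `g ^ r`. -/
noncomputable def rescale (g : G) (r : ℕ) (c : ℕ → ListChain X) (i : ℕ) : ListChain X :=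
  if Even i then (r : ℤ) ^ (i / 2) • c i else (r : ℤ) ^ (i / 2) • normOp g r (c i)

lemma normOp_mul_normOp {g : G} {q r : ℕ} (hg : g ^ q = 1) :
    (normOp g q : Module.End ℤ (ListChain X)) * normOp g r = (r : ℤ) • normOp g q := by
  have h1 : (normOp g q : Module.End ℤ (ListChain X)) * act g = normOp g q := by
    have := stepOp_succ_mul (X := X) hg 0
    rw [stepOp, stepOp, if_neg (by decide), if_pos (by decide), mul_sub, mul_one] at this
    exact sub_eq_zero.1 this
  have h2 : ∀ i, (normOp g q : Module.End ℤ (ListChain X)) * act g ^ i = normOp g q := by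
    intro i
    induction i with
    | zero => simp
    | succ i ih => rw [pow_succ, ← mul_assoc, ih, h1]
  conv_lhs => rw [normOp.eq_def g r, Finset.mul_sum, Finset.sum_congr rfl fun i _ => h2 i]
  simp

lemma IsResolution.rescale {U : Set (X × X)} (hU : IsInvariant G U) {g : G} {q r : ℕ} [NeZero q]
    (hg : g ^ q = 1) (hr : r.Coprime q) {n : ℕ} {c : ℕ → ListChain X}
    (hc : IsResolution Set.univ U g q n c) :
    IsResolution Set.univ U (g ^ r) q n (rescale g r c) where
  mem i hi := by
    unfold ListChain.rescale
    split_ifs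
    · exact Submodule.smul_mem _ _ (hc.mem i hi)
    · exact Submodule.smul_mem _ _
        (normOp_mem_small hU (fun _ _ => Set.mem_univ _) r (hc.mem i hi))
  boundary_succ i hi := by
    have h := hc.boundary_succ i hi
    rcases Nat.even_or_odd i with he | ho
    · have h2 : (i + 1) / 2 = i / 2 := by obtain ⟨k, rfl⟩ := he; omega
      rw [stepOp, if_pos he] at h ⊢
      rw [ListChain.rescale, if_neg (by simpa [Nat.even_add_one] using he), ListChain.rescale,
        if_pos he, map_smul, map_smul, boundary_normOp, h, h2, ← Module.End.mul_apply, normOp,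
        geom_sum_mul, map_pow]
    · have h2 : (i + 1) / 2 = i / 2 + 1 := by obtain ⟨k, rfl⟩ := ho; omega
      have ho' : ¬ Even i := by simpa using ho
      rw [stepOp, if_neg ho'] at h ⊢
      rw [ListChain.rescale, if_pos ho.add_one, ListChain.rescale, if_neg ho', map_smul, map_smul,
        h, h2, normOp_pow hg hr, ← Module.End.mul_apply, normOp_mul_normOp hg, pow_succ, mul_smul]
      rfl

lemma IsResolution.act {U : Set (X × X)} (hU : IsInvariant G U) {g h : G} {q r : ℕ} [NeZero q]
    (hg : g ^ q = 1) (hr : r.Coprime q) (hgh : h * g = g ^ r * h) {n : ℕ} {c : ℕ → ListChain X}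
    (hc : IsResolution Set.univ U g q n c) :
    IsResolution Set.univ U (g ^ r) q n fun i => ListChain.act h (c i) where
  mem i hi := act_mem_small hU (fun _ _ => Set.mem_univ _) (hc.mem i hi)
  boundary_succ i hi := by
    rw [boundary_act, hc.boundary_succ i hi, ← Module.End.mul_apply, ← Module.End.mul_apply]
    congr 1
    unfold stepOp
    split_ifs
    · rw [mul_sub, sub_mul, ← map_mul, ← map_mul, hgh, mul_one, one_mul]
    · rw [normOp_pow hg hr, act_mul_normOp hg hr hgh]

lemma IsResolution.sub {U : Set (X × X)} {g : G} {q n : ℕ} {c d : ℕ → ListChain X}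
    (hc : IsResolution Set.univ U g q n c) (hd : IsResolution Set.univ U g q n d) :
    IsResolution Set.univ U g q n fun i => c i - d i where
  mem i hi := Submodule.sub_mem _ (hc.mem i hi) (hd.mem i hi)
  boundary_succ i hi := by
    rw [map_sub, map_sub, hc.boundary_succ i hi, hd.boundary_succ i hi]

variable [UniformSpace X]

/-- The key number-theoretic consequence of noncommutativity: a resolution of length eight exists
at every scale, although the space has nontrivial homology in degree seven. -/
theorem exists_isResolution_eight [Finite G]
    (hunif : ∀ γ : G, UniformContinuous fun x : X => γ • x)
    (hA : AcyclicBelow (Set.univ : Set X) 8) (hdeg : HasDegree (Set.univ : Set X) 8)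
    {g h : G} {p q r : ℕ} (hp : Odd p) (hqp : q.Prime) (hq : Odd q) (hg : g ^ q = 1)
    (hh : h ^ p = 1) (hgh : h * g = g ^ r * h) (hr : r.Coprime q) (hr4 : (r : ZMod q) ^ 4 ≠ 1)
    {U : Set (X × X)} (hU : U ∈ 𝓤 X) :
    ∃ c, IsResolution Set.univ U g q 8 c ∧ boundary (c 0) = single [] 1 := by
  have : NeZero q := ⟨hqp.ne_zero⟩
  have hgr : (g ^ r) ^ q = 1 := by rw [← pow_mul, mul_comm, pow_mul, hg, one_pow]
  obtain ⟨U₀', hU₀', D, hD0', hD⟩ := hdeg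
  obtain ⟨U₀, hU₀, hU₀s, hU₀i⟩ := exists_isInvariant_subset hunif (Filter.inter_mem hU₀' hU)
  have hD0 : ∀ w ∈ small Set.univ U₀ 9, D (boundary w) = 0 := fun w hw =>
    hD0' w (small_mono subset_rfl (fun p hp => (hU₀s hp).1) _ hw)
  obtain ⟨V', hV', hDV'⟩ := hD U₀ hU₀
  obtain ⟨V, hV, hVs, hVi⟩ := exists_isInvariant_subset hunif (Filter.inter_mem hV' hU₀)
  have hDV : ∀ z ∈ small Set.univ V 8, boundary z = 0 → D z = 0 →
      ∃ w ∈ small Set.univ U₀ 9, boundary w = z := fun z hz =>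
    hDV' z (small_mono subset_rfl (fun p hp => (hVs hp).1) _ hz)
  let Z : Submodule ℤ (ListChain X) := small Set.univ V 8 ⊓ LinearMap.ker boundary
  have hZ : ∀ (γ : G), ∀ z ∈ Z, ListChain.act γ z ∈ Z := fun γ z hz =>
    ⟨act_mem_small hVi (fun _ _ => Set.mem_univ _) hz.1, by
      change boundary _ = 0
      rw [boundary_act, LinearMap.mem_ker.1 hz.2, map_zero]⟩
  have hDZ : ∀ (γ : G), ∀ z ∈ Z, D z = 0 → D (ListChain.act γ z) = 0 := by
    intro γ z hz hz0
    obtain ⟨w, hw, rfl⟩ := hDV z hz.1 hz.2 hz0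
    rw [← boundary_act]
    exact hD0 _ (act_mem_small hU₀i (fun _ _ => Set.mem_univ _) hw)
  have hDh : ∀ z ∈ Z, D (ListChain.act h z) = D z := fun z hz => degree_act_eq hZ hDZ hp hh hz
  have hDN : ∀ z ∈ Z, D (normOp g q z) = q * D z := by
    intro z hz
    rw [normOp, LinearMap.sum_apply, map_sum, Finset.sum_congr rfl fun i _ => ?_,
      Finset.sum_const, Finset.card_range, nsmul_eq_mul]
    rw [← map_pow]
    exact degree_act_eq hZ hDZ hq (by rw [← pow_mul, mul_comm, pow_mul, hg, one_pow]) hz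
  obtain ⟨W', hW', hW'V, huniq⟩ := exists_cycle_of_isResolution hunif hA hgr 7 (by norm_num) hV
  obtain ⟨W, hW, hWW', hWi⟩ := exists_isInvariant_subset hunif hW'
  obtain ⟨c, hc, hc0⟩ := exists_isResolution hunif hA hg 7 (by norm_num) hW
  obtain ⟨y, hy, hy0, hyd⟩ := huniq (fun i => ListChain.act h (c i) - rescale g r c i)
    (by
      have := (hc.act hWi hg hr hgh).sub (hc.rescale hWi hg hr)
      exact ⟨fun i hi => small_mono subset_rfl hWW' _ (this.mem i hi), this.boundary_succ⟩)
    (by simp [boundary_act, hc0, act_single_nil, rescale])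
  have hodd7 : ¬ Even 7 := by decide
  have hNc : normOp g q (c 7) ∈ Z := by
    refine ⟨normOp_mem_small hVi (fun _ _ => Set.mem_univ _) q
      (small_mono subset_rfl (hWW'.trans hW'V) _ (hc.mem 7 le_rfl)), ?_⟩
    have h6 := hc.boundary_succ 6 (by norm_num)
    have h76 := stepOp_succ_mul (X := X) hg 6
    rw [stepOp, if_neg hodd7] at h76
    change boundary _ = 0
    rw [boundary_normOp, h6, ← Module.End.mul_apply, h76,
      LinearMap.zero_apply]
  have hyZ : y ∈ Z := ⟨hy, hy0⟩
  set K := D (normOp g q (c 7)) with hK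
  have hKy : K - r ^ 4 * K = q * D y := by
    rw [stepOp, if_neg hodd7, normOp_pow hg hr, map_sub, ← Module.End.mul_apply,
      ← act_mul_normOp hg hr hgh, rescale, if_neg hodd7, map_smul,
      ← Module.End.mul_apply (normOp g q) (normOp g r), normOp_mul_normOp hg] at hyd
    rw [← hDN y hyZ, ← hyd, map_sub, Module.End.mul_apply, hDh _ hNc, map_smul,
      LinearMap.smul_apply, map_smul, ← hK]
    simp only [smul_eq_mul]
    ring
  obtain ⟨a, b, hab⟩ : ∃ a b : ℤ, a * (1 - r ^ 4) + b * q = 1 := by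
    have : IsCoprime (1 - r ^ 4 : ℤ) q := by
      rw [isCoprime_comm, (Nat.prime_iff_prime_int.1 hqp).irreducible.coprime_iff_not_dvd,
        ← ZMod.intCast_zmod_eq_zero_iff_dvd]
      push_cast
      rw [sub_eq_zero]
      exact hr4.symm
    obtain ⟨a, b, h⟩ := this
    exact ⟨a, b, h⟩
  have hy' : a • y + b • normOp g q (c 7) ∈ Z :=
    Submodule.add_mem _ (Submodule.smul_mem _ _ hyZ) (Submodule.smul_mem _ _ hNc)
  set y' := a • y + b • normOp g q (c 7) with hy'def
  have hDy' : D (normOp g q (c 7 - y')) = 0 := by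
    rw [map_sub, map_sub, hDN _ hy', ← hK, hy'def, map_add, map_smul, map_smul, ← hK,
      smul_eq_mul, smul_eq_mul]
    linear_combination a * hKy - K * hab
  have hc7 : c 7 - y' ∈ small Set.univ V 8 := Submodule.sub_mem _
    (small_mono subset_rfl (hWW'.trans hW'V) _ (hc.mem 7 le_rfl)) hy'.1
  have hcyc : boundary (c 7 - y') = stepOp g q 6 (c 6) := by
    rw [map_sub, LinearMap.mem_ker.1 hy'.2, sub_zero]
    exact hc.boundary_succ 6 (by norm_num)
  obtain ⟨w, hw, hw0⟩ := hDV (normOp g q (c 7 - y'))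
    (normOp_mem_small hVi (fun _ _ => Set.mem_univ _) q hc7)
    (by rw [map_sub, map_sub, LinearMap.mem_ker.1 hNc.2, boundary_normOp,
      LinearMap.mem_ker.1 hy'.2, map_zero, sub_zero]) hDy'
  have hWU : W ⊆ U := fun p hp => (hU₀s (hVs (hW'V (hWW' hp))).2).2
  refine ⟨fun i => if i = 8 then w else if i = 7 then c 7 - y' else c i, ⟨?_, ?_⟩, by simp [hc0]⟩
  · intro i hi
    by_cases h8 : i = 8
    · subst h8
      exact small_mono subset_rfl (fun p hp => (hU₀s hp).2) _ hw
    by_cases h7 : i = 7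
    · subst h7
      exact small_mono subset_rfl (fun p hp => (hU₀s (hVs hp).2).2) _ hc7
    · simp only [if_neg h8, if_neg h7]
      exact small_mono subset_rfl hWU _ (hc.mem i (by omega))
  · intro i hi
    by_cases h7 : i = 7
    · subst h7
      rw [stepOp, if_neg hodd7]
      simpa using hw0
    by_cases h6 : i = 6
    · subst h6
      simpa using hcyc
    · simp only [if_neg h7, if_neg (show i ≠ 8 by omega), if_neg (show i + 1 ≠ 8 by omega),
        if_neg (show i + 1 ≠ 7 by omega)]
      exact hc.boundary_succ i (by omega)

end Action

end ListChain

namespace ListChain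

open Finsupp

/-! ### Removing a coloured piece from a resolution -/

section Colour

variable {G X : Type*} [Group G] [MulAction G X] {q : ℕ}

/-- The nonempty lists of points of `P` of one colour. -/
def monoLists (P : Set X) (colour : X → ZMod q) : Set (List X) :=
  {l | l ≠ [] ∧ ∃ k, ∀ x ∈ l, x ∈ P ∧ colour x = k}

/-- Write a list of colour `j` as `g ^ j • l₀` and send it to the sum of the `g ^ i • l₀`
for `i < j`. -/
noncomputable def sumOp (g : G) (colour : X → ZMod q) : Module.End ℤ (ListChain X) :=
  Finsupp.linearCombination ℤ fun l => match l with
    | [] => 0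
    | x :: l => normOp g (colour x).val (act (g ^ (colour x).val)⁻¹ (single (x :: l) 1))

/-- Translate the lists of colour `q - 1` to lists of colour `0`, and send the others to zero. -/
noncomputable def lastOp (g : G) (colour : X → ZMod q) : Module.End ℤ (ListChain X) :=
  Finsupp.linearCombination ℤ fun l => match l with
    | [] => 0
    | x :: l => if (colour x).val + 1 = q then act g (single (x :: l) 1) else 0

/-- `P` is stable under `g` and `g` shifts the colour of the points of `P` by one. -/
structure IsColouring (g : G) (P : Set X) (colour : X → ZMod q) : Prop where
  smul_mem : ∀ x ∈ P, g • x ∈ P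
  colour_smul : ∀ x ∈ P, colour (g • x) = colour x + 1

variable {g : G} {P : Set X} {colour : X → ZMod q}

lemma sumOp_single {l : List X} (hl : l ≠ []) {k : ZMod q} (hk : ∀ x ∈ l, colour x = k) :
    sumOp g colour (single l 1) = normOp g k.val (act (g ^ k.val)⁻¹ (single l 1)) := by
  obtain ⟨x, l, rfl⟩ := List.exists_cons_of_ne_nil hl
  obtain rfl := hk x (by simp)
  rw [sumOp, Finsupp.linearCombination_single, one_smul]

lemma lastOp_single {l : List X} (hl : l ≠ []) {k : ZMod q} (hk : ∀ x ∈ l, colour x = k) :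
    lastOp g colour (single l 1) = if k.val + 1 = q then act g (single l 1) else 0 := by
  obtain ⟨x, l, rfl⟩ := List.exists_cons_of_ne_nil hl
  obtain rfl := hk x (by simp)
  rw [lastOp, Finsupp.linearCombination_single, one_smul]

lemma IsColouring.pow_smul (h : IsColouring g P colour) (i : ℕ) {x : X} (hx : x ∈ P) :
    g ^ i • x ∈ P ∧ colour (g ^ i • x) = colour x + i := by
  induction i with
  | zero => simpa using hx
  | succ i ih =>
    rw [pow_succ', mul_smul]
    refine ⟨h.smul_mem _ ih.1, ?_⟩
    rw [h.colour_smul _ ih.1, ih.2]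
    push_cast
    ring

lemma inv_pow_eq [NeZero q] (hg : g ^ q = 1) (k : ZMod q) : (g ^ k.val)⁻¹ = g ^ (q - k.val) := by
  rw [inv_eq_iff_mul_eq_one, ← pow_add, Nat.add_sub_cancel' k.val_lt.le, hg]

/-- Monochromatic lists are translates of lists of colour zero. -/
lemma IsColouring.exists_eq_act (h : IsColouring g P colour) [NeZero q] (hg : g ^ q = 1)
    {l : List X} (hl : l ∈ monoLists P colour) :
    ∃ l₀ : List X, l₀ ≠ [] ∧ (∀ x ∈ l₀, x ∈ P ∧ colour x = 0) ∧ ∃ j < q,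
      single l (1 : ℤ) = act (g ^ j) (single l₀ 1) := by
  obtain ⟨hne, k, hk⟩ := hl
  refine ⟨l.map ((g ^ k.val)⁻¹ • ·), by simpa using hne, fun x hx => ?_, k.val, k.val_lt, ?_⟩
  · obtain ⟨y, hy, rfl⟩ := List.mem_map.1 hx
    have := h.pow_smul (q - k.val) (hk y hy).1
    rw [← inv_pow_eq hg] at this
    refine ⟨this.1, this.2.trans ?_⟩
    rw [(hk y hy).2, Nat.cast_sub k.val_lt.le]
    simp
  · rw [act_apply, push_single, List.map_map]
    simp [Function.comp_def]

lemma IsColouring.sumOp_act (h : IsColouring g P colour) {l : List X} (hl : l ≠ [])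
    (h0 : ∀ x ∈ l, x ∈ P ∧ colour x = 0) {j : ℕ} (hj : j < q) :
    sumOp g colour (act (g ^ j) (single l 1)) = normOp g j (single l 1) := by
  rw [act_apply, push_single, sumOp_single (k := (j : ZMod q)) (by simpa using hl),
    ZMod.val_cast_of_lt hj, act_apply, push_single, List.map_map]
  · simp [Function.comp_def]
  · intro x hx
    obtain ⟨y, hy, rfl⟩ := List.mem_map.1 hx
    rw [(h.pow_smul j (h0 y hy).1).2, (h0 y hy).2, zero_add]

lemma IsColouring.lastOp_act (h : IsColouring g P colour) (hg : g ^ q = 1) {l : List X}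
    (hl : l ≠ []) (h0 : ∀ x ∈ l, x ∈ P ∧ colour x = 0) {j : ℕ} (hj : j < q) :
    lastOp g colour (act (g ^ j) (single l 1)) = if j + 1 = q then single l 1 else 0 := by
  have : lastOp g colour (act (g ^ j) (single l 1)) =
      if j + 1 = q then act g (act (g ^ j) (single l 1)) else 0 := by
    rw [act_apply (g ^ j), push_single, lastOp_single (k := (j : ZMod q)) (by simpa using hl),
      ZMod.val_cast_of_lt hj]
    intro x hx
    obtain ⟨y, hy, rfl⟩ := List.mem_map.1 hx
    rw [(h.pow_smul j (h0 y hy).1).2, (h0 y hy).2, zero_add]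
  rw [this]
  split_ifs with hq
  · rw [act_act, ← pow_succ', hq, hg, map_one, Module.End.one_apply]
  · rfl

lemma normOp_succ_apply (g : G) (j : ℕ) (z : ListChain X) :
    normOp g (j + 1) z = normOp g j z + act (g ^ j) z := by
  rw [normOp, Finset.sum_range_succ, LinearMap.add_apply, ← map_pow]
  rfl

lemma act_normOp (g : G) (j : ℕ) (z : ListChain X) :
    act g (normOp g j z) = normOp g j z + act (g ^ j) z - z := by
  induction j with
  | zero => simp [normOp]
  | succ j ih =>
    rw [normOp_succ_apply, map_add, ih, act_act, ← pow_succ']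
    abel

lemma normOp_act (g : G) (j : ℕ) (z : ListChain X) :
    normOp g j (act g z) = normOp g j z + act (g ^ j) z - z := by
  induction j with
  | zero => simp [normOp]
  | succ j ih =>
    rw [normOp_succ_apply, ih, normOp_succ_apply, act_act, ← pow_succ]
    abel

lemma normOp_act_pow (hg : g ^ q = 1) (j : ℕ) (z : ListChain X) :
    normOp g q (act (g ^ j) z) = normOp g q z := by
  induction j with
  | zero => simp
  | succ j ih =>
    rw [pow_succ', ← act_act, normOp_act, ih, hg, map_one, Module.End.one_apply]
    abel

lemma IsColouring.sumOp_add_normOp (h : IsColouring g P colour) [NeZero q] (hg : g ^ q = 1)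
    {z : ListChain X} (hz : z ∈ Finsupp.supported ℤ ℤ (monoLists P colour)) :
    sumOp g colour (act g z - z) + normOp g q (lastOp g colour z) = z := by
  refine eqOn_supported (S := sumOp g colour ∘ₗ (act g - 1) + normOp g q ∘ₗ lastOp g colour)
    (T := LinearMap.id) (fun l hl => ?_) hz
  obtain ⟨l₀, hne, h0, j, hj, hl₀⟩ := h.exists_eq_act hg hl
  simp only [LinearMap.add_apply, LinearMap.comp_apply, LinearMap.sub_apply, Module.End.one_apply,
    LinearMap.id_apply, map_sub]
  rw [hl₀, act_act, ← pow_succ', h.sumOp_act hne h0 hj, h.lastOp_act hg hne h0 hj]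
  split_ifs with hq
  · have : sumOp g colour (act (g ^ (j + 1)) (single l₀ 1)) = 0 := by
      have := h.sumOp_act hne h0 (j := 0) (by omega)
      rw [pow_zero] at this
      rw [hq, hg, this]
      simp [normOp]
    rw [this]
    subst hq
    rw [normOp_succ_apply]
    abel
  · rw [h.sumOp_act hne h0 (by omega), normOp_succ_apply]
    simp

lemma IsColouring.lastOp_add_sumOp (h : IsColouring g P colour) [NeZero q] (hg : g ^ q = 1)
    {z : ListChain X} (hz : z ∈ Finsupp.supported ℤ ℤ (monoLists P colour)) :
    lastOp g colour (normOp g q z) + (act g (sumOp g colour z) - sumOp g colour z) = z := by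
  refine eqOn_supported (S := lastOp g colour ∘ₗ normOp g q + (act g - 1) ∘ₗ sumOp g colour)
    (T := LinearMap.id) (fun l hl => ?_) hz
  obtain ⟨l₀, hne, h0, j, hj, hl₀⟩ := h.exists_eq_act hg hl
  simp only [LinearMap.add_apply, LinearMap.comp_apply, LinearMap.sub_apply, Module.End.one_apply,
    LinearMap.id_apply]
  have hN : lastOp g colour (normOp g q (single l₀ 1)) = single l₀ 1 := by
    rw [normOp, LinearMap.sum_apply, map_sum,
      Finset.sum_eq_single_of_mem (q - 1) (Finset.mem_range.2 (by omega))]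
    · rw [← map_pow, h.lastOp_act hg hne h0 (by omega), if_pos (by omega)]
    · intro i hi hiq
      rw [Finset.mem_range] at hi
      rw [← map_pow, h.lastOp_act hg hne h0 hi, if_neg (by omega)]
  rw [hl₀, normOp_act_pow hg, hN, h.sumOp_act hne h0 hj, act_normOp]
  abel

lemma boundary_sumOp {z : ListChain X}
    (hz : z ∈ Finsupp.supported ℤ ℤ {l | l ∈ monoLists P colour ∧ 2 ≤ l.length}) :
    boundary (sumOp g colour z) = sumOp g colour (boundary z) := by
  refine eqOn_supported (S := boundary ∘ₗ sumOp g colour) (T := sumOp g colour ∘ₗ boundary)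
    (fun l hl => ?_) hz
  obtain ⟨⟨hne, k, hk⟩, hlen⟩ := hl
  rw [LinearMap.comp_apply, LinearMap.comp_apply, sumOp_single hne fun x hx => (hk x hx).2,
    boundary_normOp, boundary_act]
  refine (eqOn_supported (S := sumOp g colour) (T := normOp g k.val * act (g ^ k.val)⁻¹)
    (fun l' hl' => ?_) (boundary_single_mem l)).symm
  obtain ⟨hs, hl'⟩ := hl'
  exact sumOp_single (by rintro rfl; simp at hl'; omega) fun x hx => (hk x (hs.subset hx)).2

lemma boundary_lastOp {z : ListChain X}
    (hz : z ∈ Finsupp.supported ℤ ℤ {l | l ∈ monoLists P colour ∧ 2 ≤ l.length}) :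
    boundary (lastOp g colour z) = lastOp g colour (boundary z) := by
  refine eqOn_supported (S := boundary ∘ₗ lastOp g colour) (T := lastOp g colour ∘ₗ boundary)
    (fun l hl => ?_) hz
  obtain ⟨⟨hne, k, hk⟩, hlen⟩ := hl
  have key : ∀ l' : List X, l' ≠ [] → l' ⊆ l →
      lastOp g colour (single l' 1) =
        (if k.val + 1 = q then act g else 0 : Module.End ℤ (ListChain X)) (single l' 1) := by
    intro l' hl' hs
    rw [lastOp_single hl' fun x hx => (hk x (hs hx)).2]
    split_ifs <;> rfl
  rw [LinearMap.comp_apply, LinearMap.comp_apply, key l hne (List.Subset.refl l)]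
  have := eqOn_supported (S := lastOp g colour)
    (T := (if k.val + 1 = q then act g else 0 : Module.End ℤ (ListChain X)))
    (fun l' hl' => key l' (by rintro rfl; have := hl'.2; simp at this; omega) hl'.1.subset)
    (boundary_single_mem l)
  rw [this]
  split_ifs
  · rw [boundary_act]
  · simp

lemma sumOp_mem_small [NeZero q] (hg : g ^ q = 1) {U : Set (X × X)} (hU : IsInvariant G U)
    {Y : Set X} (hY : ∀ x ∈ Y, g • x ∈ Y) {n : ℕ} {z : ListChain X} (hz : z ∈ small Y U n) :
    sumOp g colour z ∈ small Y U n := by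
  refine map_mem_of_supported (fun l hl => ?_) hz
  cases l with
  | nil => simp [sumOp]
  | cons x l =>
    rw [sumOp, Finsupp.linearCombination_single, one_smul]
    refine normOp_mem_small hU hY _ ?_
    rw [inv_pow_eq hg]
    exact act_pow_mem_small hU hY _ (single_mem_small hl 1)

lemma lastOp_mem_small {U : Set (X × X)} (hU : IsInvariant G U)
    {Y : Set X} (hY : ∀ x ∈ Y, g • x ∈ Y) {n : ℕ} {z : ListChain X} (hz : z ∈ small Y U n) :
    lastOp g colour z ∈ small Y U n := by
  refine map_mem_of_supported (fun l hl => ?_) hz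
  cases l with
  | nil => simp [lastOp]
  | cons x l =>
    rw [lastOp, Finsupp.linearCombination_single, one_smul]
    dsimp only
    split_ifs
    · exact act_mem_small hU hY (single_mem_small hl 1)
    · exact Submodule.zero_mem _

variable (q) in
/-- The augmentation modulo `q`. -/
noncomputable def augmentation : ListChain X →ₗ[ℤ] ZMod q :=
  (Int.castAddHom (ZMod q)).toIntLinearMap ∘ₗ Finsupp.lapply [] ∘ₗ boundary

lemma augmentation_apply (z : ListChain X) : augmentation q z = (boundary z [] : ℤ) := rfl

lemma augmentation_single (x : X) : augmentation q (single [x] 1) = 1 := by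
  simp [augmentation_apply, boundary_single_cons]

/-- The sum of the colours of the points of a chain of points. -/
noncomputable def totalColour (colour : X → ZMod q) : ListChain X →ₗ[ℤ] ZMod q :=
  Finsupp.linearCombination ℤ fun l => (l.map colour).sum

lemma totalColour_single (l : List X) :
    totalColour colour (single l 1) = (l.map colour).sum := by
  rw [totalColour, Finsupp.linearCombination_single, one_smul]

lemma totalColour_boundary {z : ListChain X}
    (hz : z ∈ Finsupp.supported ℤ ℤ {l | l ∈ monoLists P colour ∧ l.length = 2}) :
    totalColour colour (boundary z) = 0 := by
  refine eqOn_supported (S := totalColour colour ∘ₗ boundary) (T := 0) (fun l hl => ?_) hz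
  obtain ⟨⟨-, k, hk⟩, hl⟩ := hl
  obtain ⟨x, y, rfl⟩ := List.length_eq_two.1 hl
  simp [boundary_single_cons, totalColour_single, (hk x (by simp)).2, (hk y (by simp)).2]

lemma IsColouring.totalColour_act_sub (h : IsColouring g P colour) {z : ListChain X}
    (hz : z ∈ Finsupp.supported ℤ ℤ {l | l ∈ monoLists P colour ∧ l.length = 1}) :
    totalColour colour (act g z - z) = augmentation q z := by
  refine eqOn_supported (S := totalColour colour ∘ₗ (act g - 1)) (fun l hl => ?_) hz
  obtain ⟨⟨-, k, hk⟩, hl⟩ := hl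
  obtain ⟨x, rfl⟩ := List.length_eq_one_iff.1 hl
  rw [augmentation_single]
  simp [act_apply, totalColour_single, h.colour_smul x (hk x (by simp)).1]

lemma augmentation_sumOp [NeZero q] {z : ListChain X}
    (hz : z ∈ Finsupp.supported ℤ ℤ {l : List X | l.length = 1}) :
    augmentation q (sumOp g colour z) = totalColour colour z := by
  refine eqOn_supported (S := augmentation q ∘ₗ sumOp g colour) (fun l hl => ?_) hz
  obtain ⟨x, rfl⟩ := List.length_eq_one_iff.1 hl
  rw [LinearMap.comp_apply, sumOp_single (by simp) (k := colour x) (by simp), augmentation_apply,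
    boundary_normOp, boundary_act, boundary_single_cons, totalColour_single]
  simp [normOp, ← map_pow, act_single_nil, LinearMap.sum_apply]

lemma boundary_mem_mono {n : ℕ} {z : ListChain X}
    (hz : z ∈ Finsupp.supported ℤ ℤ {l | l ∈ monoLists P colour ∧ l.length = n + 1 + 1}) :
    boundary z ∈ Finsupp.supported ℤ ℤ {l | l ∈ monoLists P colour ∧ l.length = n + 1} := by
  refine map_mem_of_supported (fun l hl => ?_) hz
  refine Finsupp.supported_mono ?_ (boundary_single_mem l)
  rintro l' ⟨hs, hlen⟩
  obtain ⟨⟨-, k, hk⟩, hl⟩ := hl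
  exact ⟨⟨by rintro rfl; simp at hlen; omega, k, fun x hx => hk x (hs.subset hx)⟩, by omega⟩

lemma IsColouring.act_pow_mem_mono (h : IsColouring g P colour) (i : ℕ) {n : ℕ} {z : ListChain X}
    (hz : z ∈ Finsupp.supported ℤ ℤ {l | l ∈ monoLists P colour ∧ l.length = n}) :
    act (g ^ i) z ∈ Finsupp.supported ℤ ℤ {l | l ∈ monoLists P colour ∧ l.length = n} := by
  refine map_mem_of_supported (fun l hl => ?_) hz
  obtain ⟨⟨hne, k, hk⟩, hl⟩ := hl
  rw [act_apply, push_single]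
  refine Finsupp.single_mem_supported _ _ ⟨⟨by simpa using hne, k + i, fun x hx => ?_⟩, by simpa⟩
  obtain ⟨y, hy, rfl⟩ := List.mem_map.1 hx
  have := h.pow_smul i (hk y hy).1
  rwa [(hk y hy).2] at this

lemma IsColouring.stepOp_mem_mono (h : IsColouring g P colour) (i : ℕ) {n : ℕ} {z : ListChain X}
    (hz : z ∈ Finsupp.supported ℤ ℤ {l | l ∈ monoLists P colour ∧ l.length = n}) :
    stepOp g q i z ∈ Finsupp.supported ℤ ℤ {l | l ∈ monoLists P colour ∧ l.length = n} := by
  unfold stepOp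
  split_ifs
  · refine Submodule.sub_mem _ ?_ hz
    simpa using h.act_pow_mem_mono 1 hz
  · rw [normOp, LinearMap.sum_apply]
    refine Submodule.sum_mem _ fun j _ => ?_
    rw [← map_pow]
    exact h.act_pow_mem_mono j hz

lemma IsResolution.exists_removeColour [NeZero q] (hg : g ^ q = 1) (h : IsColouring g P colour)
    {U : Set (X × X)} (hU : IsInvariant G U) {Y B : Set X} (hY : ∀ x ∈ Y, g • x ∈ Y)
    (hB : ∀ x ∈ B, ∀ y, (x, y) ∈ U → y ∈ P ∧ colour y = colour x) {n : ℕ}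
    {c : ℕ → ListChain X} (hc : IsResolution (Y ∪ B) U g q (n + 1) c) :
    ∃ c', IsResolution Y U g q n c' ∧ augmentation q (c' 0) = augmentation q (c 0) := by
  set a : ℕ → ListChain X := fun i => restrictTo Y (c i) with ha_def
  obtain ⟨b, hb_def⟩ : ∃ b : ℕ → ListChain X, ∀ i, b i = c i - a i := ⟨_, fun _ => rfl⟩
  obtain ⟨s, hs_def⟩ : ∃ s : ℕ → ListChain X,
    ∀ i, s i = boundary (b (i + 1)) - stepOp g q i (b i) := ⟨_, fun _ => rfl⟩
  have ha : ∀ i ≤ n + 1, a i ∈ small Y U (i + 1) := fun i hi =>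
    small_mono Set.inter_subset_right subset_rfl _ (restrictTo_mem_small Y (hc.mem i hi))
  have hb : ∀ i ≤ n + 1, b i ∈
      Finsupp.supported ℤ ℤ {l | l ∈ monoLists P colour ∧ l.length = i + 1} := by
    intro i hi
    rw [hb_def]
    refine Finsupp.supported_mono ?_ (sub_restrictTo_mem (hc.mem i hi))
    rintro l ⟨hl, x, hx, hxY⟩
    refine ⟨⟨List.ne_nil_of_mem hx, colour x, fun y hy => ?_⟩, hl.1⟩
    exact hB x ((hl.2.1 x hx).resolve_left hxY) y (hl.2.2 x hx y hy)
  have hs_eq : ∀ i ≤ n, s i = stepOp g q i (a i) - boundary (a (i + 1)) := by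
    intro i hi
    simp only [hs_def, hb_def, map_sub, hc.boundary_succ i (by omega)]
    abel
  have hs_small : ∀ i ≤ n, s i ∈ small Y U (i + 1) := by
    intro i hi
    rw [hs_eq i hi]
    exact Submodule.sub_mem _ (stepOp_mem_small hU hY q i (ha i (by omega)))
      (boundary_mem_small (ha (i + 1) (by omega)))
  have hs_mono : ∀ i ≤ n, s i ∈
      Finsupp.supported ℤ ℤ {l | l ∈ monoLists P colour ∧ l.length = i + 1} := by
    intro i hi
    rw [hs_def]
    exact Submodule.sub_mem _ (boundary_mem_mono (hb (i + 1) (by omega)))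
      (h.stepOp_mem_mono i (hb i (by omega)))
  have hs_boundary : ∀ i < n, boundary (s (i + 1)) = - stepOp g q (i + 1) (s i) := by
    intro i hi
    have := LinearMap.congr_fun (stepOp_succ_mul (X := X) hg i) (b i)
    rw [Module.End.mul_apply, LinearMap.zero_apply] at this
    simp only [hs_def, map_sub, boundary_boundary, boundary_stepOp, this]
    abel
  have hmono : ∀ i, Finsupp.supported ℤ ℤ {l | l ∈ monoLists P colour ∧ l.length = i + 1} ≤
      Finsupp.supported ℤ ℤ (monoLists P colour) := fun i => Finsupp.supported_mono fun l hl => hl.1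
  have hmono2 : ∀ i, Finsupp.supported ℤ ℤ {l | l ∈ monoLists P colour ∧ l.length = i + 1 + 1} ≤
      Finsupp.supported ℤ ℤ {l | l ∈ monoLists P colour ∧ 2 ≤ l.length} := fun i =>
    Finsupp.supported_mono fun l hl => ⟨hl.1, by have := hl.2; omega⟩
  refine ⟨fun i => a i - if Even i then sumOp g colour (s i) else lastOp g colour (s i),
    ⟨fun i hi => ?_, fun i hi => ?_⟩, ?_⟩
  · refine Submodule.sub_mem _ (ha i (by omega)) ?_
    split_ifs
    · exact sumOp_mem_small hg hU hY (hs_small i hi)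
    · exact lastOp_mem_small hU hY (hs_small i hi)
  · have hai := hs_eq i hi.le
    have hsi := hs_boundary i hi
    rcases Nat.even_or_odd i with hev | hodd
    · have h1 : ¬ Even (i + 1) := by simpa [Nat.even_add_one] using hev
      have key := h.lastOp_add_sumOp hg (hmono i (hs_mono i hi.le))
      simp only [stepOp, if_pos hev, if_neg h1] at hai hsi ⊢
      rw [map_sub, map_sub, boundary_lastOp (hmono2 i (hs_mono (i + 1) hi)), hsi, map_neg,
        sub_neg_eq_add, LinearMap.sub_apply, LinearMap.sub_apply, Module.End.one_apply,
        Module.End.one_apply]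
      rw [LinearMap.sub_apply, Module.End.one_apply] at hai
      rw [eq_sub_iff_add_eq, ← eq_sub_iff_add_eq'] at hai
      rw [hai, ← sub_eq_zero]
      rw [← sub_eq_zero] at key
      rw [← key]
      abel
    · have h1 : Even (i + 1) := hodd.add_one
      have h2 : ¬ Even i := by simpa using hodd
      have key := h.sumOp_add_normOp hg (hmono i (hs_mono i hi.le))
      simp only [stepOp, if_pos h1, if_neg h2] at hai hsi ⊢
      rw [map_sub, map_sub, boundary_sumOp (hmono2 i (hs_mono (i + 1) hi)), hsi, map_neg,
        sub_neg_eq_add, LinearMap.sub_apply, Module.End.one_apply]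
      rw [eq_sub_iff_add_eq, ← eq_sub_iff_add_eq'] at hai
      rw [hai, ← sub_eq_zero]
      rw [← sub_eq_zero] at key
      rw [← key]
      abel
  · have hs0 : augmentation q (sumOp g colour (s 0)) = - augmentation q (b 0) := by
      rw [augmentation_sumOp (Finsupp.supported_mono (fun l hl => hl.2) (hs_mono 0 (by omega))),
        ← h.totalColour_act_sub (hb 0 (by omega))]
      simp only [hs_def]
      rw [map_sub, totalColour_boundary (hb 1 (by omega)), zero_sub]
      rfl
    simp only [if_pos Even.zero, map_sub, hs0, hb_def]
    abel

end Colour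

end ListChain

namespace ListChain

open Finsupp
open scoped Uniformity Topology

section Sector

variable (q : ℕ)

/-- The standard primitive root of unity of order `q`. -/
noncomputable def zeta : ℂ := Complex.exp (2 * Real.pi * Complex.I / q)

variable [NeZero q]

lemma isPrimitiveRoot_zeta : IsPrimitiveRoot (zeta q) q :=
  Complex.isPrimitiveRoot_exp q (NeZero.ne q)

lemma zeta_pow_self : zeta q ^ q = 1 := (isPrimitiveRoot_zeta q).pow_eq_one

lemma norm_zeta : ‖zeta q‖ = 1 := Complex.norm_eq_one_of_pow_eq_one (zeta_pow_self q) (NeZero.ne q)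

lemma zeta_ne_zero : zeta q ≠ 0 := (isPrimitiveRoot_zeta q).ne_zero (NeZero.ne q)

/-- The principal `q`-th root of `z ^ q`. -/
noncomputable def principalRoot (z : ℂ) : ℂ := (z ^ q) ^ ((q : ℂ)⁻¹)

lemma principalRoot_pow (z : ℂ) : principalRoot q z ^ q = z ^ q :=
  Complex.cpow_nat_inv_pow _ (NeZero.ne q)

variable {q}

lemma principalRoot_ne_zero {z : ℂ} (hz : z ≠ 0) : principalRoot q z ≠ 0 := fun h =>
  pow_ne_zero q hz (by rw [← principalRoot_pow, h, zero_pow (NeZero.ne q)])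

lemma exists_sector {z : ℂ} (hz : z ≠ 0) :
    ∃ k : ZMod q, z / principalRoot q z = zeta q ^ k.val := by
  obtain ⟨i, hi, h⟩ := (isPrimitiveRoot_zeta q).eq_pow_of_pow_eq_one
    (ξ := z / principalRoot q z) (by
      rw [div_pow, principalRoot_pow, div_self (pow_ne_zero q hz)])
  exact ⟨i, by rw [ZMod.val_cast_of_lt hi, h]⟩

open Classical in
variable (q) in
/-- The index of a sector of angle `2 * π / q` containing `z`. -/
noncomputable def sector (z : ℂ) : ZMod q :=
  if hz : z ≠ 0 then (exists_sector hz).choose else 0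

lemma div_principalRoot {z : ℂ} (hz : z ≠ 0) :
    z / principalRoot q z = zeta q ^ (sector q z).val := by
  rw [sector, dif_pos hz]
  exact (exists_sector hz).choose_spec

lemma sector_eq {z : ℂ} (hz : z ≠ 0) {j : ℕ} (h : z / principalRoot q z = zeta q ^ j) :
    sector q z = j := by
  rw [div_principalRoot hz] at h
  rw [pow_eq_pow_mod j (zeta_pow_self q)] at h
  have := (isPrimitiveRoot_zeta q).pow_inj (sector q z).val_lt (Nat.mod_lt _ (NeZero.pos q)) h
  rw [← ZMod.natCast_zmod_val (sector q z), this, ZMod.natCast_mod]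

lemma sector_zeta_mul {z : ℂ} (hz : z ≠ 0) : sector q (zeta q * z) = sector q z + 1 := by
  have := sector_eq (q := q) (z := zeta q * z) (j := (sector q z).val + 1)
    (mul_ne_zero (zeta_ne_zero q) hz) (by
      rw [principalRoot, mul_pow, zeta_pow_self, one_mul, mul_div_assoc, pow_succ',
        ← div_principalRoot hz]
      rfl)
  simpa using this

lemma eventually_sector_eq {z : ℂ} (hz : z ^ q ∈ Complex.slitPlane) :
    ∀ᶠ w in 𝓝 z, w ≠ 0 ∧ sector q w = sector q z := by
  have hz0 : z ≠ 0 := by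
    rintro rfl
    rw [zero_pow (NeZero.ne q)] at hz
    exact Complex.slitPlane_ne_zero hz rfl
  have hcont : ContinuousAt (fun w => w / principalRoot q w) z := by
    refine continuousAt_id.div ?_ (principalRoot_ne_zero hz0)
    exact (continuousAt_id.pow q).cpow continuousAt_const hz
  have hfin : {ξ : ℂ | ∃ k : ZMod q, k ≠ sector q z ∧ ξ = zeta q ^ k.val}.Finite := by
    refine (Set.finite_range fun k : ZMod q => zeta q ^ k.val).subset ?_
    rintro ξ ⟨k, -, rfl⟩
    exact ⟨k, rfl⟩
  have hmem : z / principalRoot q z ∈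
      {ξ : ℂ | ∃ k : ZMod q, k ≠ sector q z ∧ ξ = zeta q ^ k.val}ᶜ := by
    rintro ⟨k, hk, h⟩
    have := sector_eq hz0 h
    simp at this
    exact hk this.symm
  filter_upwards [hcont.eventually_mem (hfin.isClosed.isOpen_compl.mem_nhds hmem),
    eventually_ne_nhds hz0] with w hw hw0
  refine ⟨hw0, ?_⟩
  by_contra hne
  exact hw ⟨sector q w, hne, div_principalRoot hw0⟩

lemma mem_slitPlane_of_re_nonneg {w : ℂ} (hw : w ≠ 0) (h : 0 ≤ w.re) :
    w ∈ Complex.slitPlane := by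
  rw [Complex.mem_slitPlane_iff]
  by_contra! h'
  exact hw (Complex.ext (le_antisymm h'.1 h) h'.2)

end Sector

section Cover

variable {G X : Type*} [Group G] [MulAction G X] {q : ℕ} [NeZero q] {g : G}

/-- A chain of points with the beginning of a resolution has zero augmentation when the
resolution is at least as long as the number of colours. -/
lemma augmentation_eq_zero_of_cover {ι : Type*} [DecidableEq ι] (hg : g ^ q = 1) {P B : ι → Set X}
    {colour : ι → X → ZMod q} (h : ∀ i, IsColouring g (P i) (colour i))
    {U : Set (X × X)} (hU : IsInvariant G U) (hBg : ∀ i, ∀ x ∈ B i, g • x ∈ B i)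
    (hB : ∀ i, ∀ x ∈ B i, ∀ y, (x, y) ∈ U → y ∈ P i ∧ colour i y = colour i x) (T : Finset ι)
    {c : ℕ → ListChain X} (hc : IsResolution (⋃ i ∈ T, B i) U g q T.card c) :
    augmentation q (c 0) = 0 := by
  induction T using Finset.induction_on generalizing c with
  | empty =>
    have : c 0 ∈ small (∅ : Set X) U 1 := by simpa using hc.mem 0 le_rfl
    have : c 0 = 0 := eqOn_supported (S := LinearMap.id) (T := 0) (fun l hl => by
      obtain ⟨x, rfl⟩ := List.length_eq_one_iff.1 hl.1
      exact absurd (hl.2.1 x (by simp)) (Set.notMem_empty x)) this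
    rw [this, map_zero]
  | insert i T hi ih =>
    rw [Finset.set_biUnion_insert, Set.union_comm, Finset.card_insert_of_notMem hi] at hc
    obtain ⟨c', hc', haug⟩ := hc.exists_removeColour hg (h i) hU (fun x hx => by
      simp only [Set.mem_iUnion] at hx ⊢
      obtain ⟨j, hj, hx⟩ := hx
      exact ⟨j, hj, hBg j x hx⟩) (hB i)
    rw [← haug, ih hc']

variable [UniformSpace X] [CompactSpace X]

lemma exists_entourage_sector {f : X → ℂ} (hf : Continuous f) {B : Set X} (hB : IsClosed B)
    (h : ∀ x ∈ B, f x ^ q ∈ Complex.slitPlane) :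
    ∃ U ∈ 𝓤 X, ∀ x ∈ B, ∀ y, (x, y) ∈ U → f y ≠ 0 ∧ sector q (f y) = sector q (f x) := by
  classical
  let φ : X → ℕ := fun x => if f x = 0 then 0 else (sector q (f x)).val + 1
  have hφ : ∀ x ∈ B, ContinuousAt φ x := fun x hx => by
    have hx0 : f x ≠ 0 := fun h0 => by
      have := h x hx
      rw [h0, zero_pow (NeZero.ne q)] at this
      exact Complex.slitPlane_ne_zero this rfl
    refine continuousAt_const (y := φ x) |>.congr ?_
    filter_upwards [hf.continuousAt.eventually (eventually_sector_eq (h x hx))] with y hy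
    simp only [φ, if_neg hx0, if_neg hy.1, hy.2]
  refine ⟨_, hB.isCompact.uniformContinuousAt_of_continuousAt φ hφ
    (r := SetRel.id) (DiscreteUniformity.relId_mem_uniformity ℕ), fun x hx y hxy => ?_⟩
  have hxy : φ x = φ y := by simpa using hxy hx
  have hx0 : f x ≠ 0 := fun h0 => by
      have := h x hx
      rw [h0, zero_pow (NeZero.ne q)] at this
      exact Complex.slitPlane_ne_zero this rfl
  simp only [φ, if_neg hx0] at hxy
  split_ifs at hxy with hy
  exact ⟨hy, ZMod.val_injective q (by omega)⟩

/-- An equivariant map to `ℂ ^ ι ∖ {0}` bounds the length of the resolutions with nonzero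
augmentation. -/
theorem exists_entourage_augmentation_eq_zero [Finite G]
    (hc : ∀ γ : G, UniformContinuous fun x : X => γ • x) (hg : g ^ q = 1) (hq : Odd q)
    {ι : Type*} [Fintype ι] {f : X → ι → ℂ} (hf : Continuous f) (hf0 : ∀ x, f x ≠ 0)
    (hfg : ∀ x, f (g • x) = zeta q • f x) :
    ∃ U ∈ 𝓤 X, ∀ c, IsResolution Set.univ U g q (2 * Fintype.card ι) c →
      augmentation q (c 0) = 0 := by
  classical
  obtain ⟨r, hr, hrf⟩ := isCompact_univ.exists_forall_le' (f := fun x => ‖f x‖) (a := 0)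
    hf.norm.continuousOn fun x _ => norm_pos_iff.2 (hf0 x)
  let s : ι × ℤˣ → X → ℂ := fun i x => ((i.2 : ℤ) : ℂ) * f x i.1
  let B : ι × ℤˣ → Set X := fun i => {x | r ≤ ‖s i x‖ ∧ 0 ≤ (s i x ^ q).re}
  have hs : ∀ i, Continuous (s i) := fun i =>
    continuous_const.mul ((continuous_apply i.1).comp hf)
  have hsg : ∀ i x, s i (g • x) = zeta q * s i x := fun i x => by
    simp only [s, hfg, Pi.smul_apply, smul_eq_mul]
    ring
  have hB0 : ∀ i, ∀ x ∈ B i, s i x ≠ 0 := fun i x hx h0 => by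
    have := hx.1
    rw [h0, norm_zero] at this
    exact this.not_gt hr
  have hU : ∀ i, ∃ U ∈ 𝓤 X, ∀ x ∈ B i, ∀ y, (x, y) ∈ U →
      s i y ≠ 0 ∧ sector q (s i y) = sector q (s i x) := fun i => by
    refine exists_entourage_sector (hs i) ?_ fun x hx =>
      mem_slitPlane_of_re_nonneg (pow_ne_zero q (hB0 i x hx)) hx.2
    exact (isClosed_le continuous_const (hs i).norm).inter
      (isClosed_le continuous_const (Complex.continuous_re.comp ((hs i).pow q)))
  choose U hU hUB using hU
  obtain ⟨V, hV, hVU, hVi⟩ := exists_isInvariant_subset hc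
    (Filter.iInter_mem.2 hU : ⋂ i, U i ∈ 𝓤 X)
  refine ⟨V, hV, fun c hc => ?_⟩
  refine augmentation_eq_zero_of_cover hg (P := fun i => {x | s i x ≠ 0}) (B := B)
    (colour := fun i x => sector q (s i x)) (fun i => ⟨fun x hx => ?_, fun x hx => ?_⟩) hVi
    (fun i x hx => ?_) (fun i x hx y hxy => hUB i x hx y (Set.mem_iInter.1 (hVU hxy) i))
    Finset.univ ?_
  · simpa [hsg, zeta_ne_zero] using hx
  · rw [hsg, sector_zeta_mul hx]
  · simpa only [B, Set.mem_ofPred_eq, hsg, norm_mul, norm_zeta, one_mul, mul_pow,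
      zeta_pow_self] using hx
  · have hcover : (⋃ i ∈ (Finset.univ : Finset (ι × ℤˣ)), B i) = Set.univ := by
      refine Set.eq_univ_of_forall fun x => ?_
      obtain ⟨k, hk⟩ : ∃ k, r ≤ ‖f x k‖ := by
        by_contra! hlt
        exact ((pi_norm_lt_iff hr).2 hlt).not_ge (hrf x (Set.mem_univ x))
      simp only [Set.mem_iUnion, Finset.mem_univ, exists_true_left]
      rcases le_total 0 (f x k ^ q).re with h | h
      · exact ⟨(k, 1), by simpa [s] using hk, by simpa [s] using h⟩
      · exact ⟨(k, -1), by simpa [s] using hk, by simpa [s, hq.neg_pow] using h⟩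
    rw [hcover]
    simpa [mul_comm] using hc

end Cover

end ListChain

section Extension

open MeasureTheory Metric

variable {E : Type*} [NormedAddCommGroup E] [NormedSpace ℝ E] [FiniteDimensional ℝ E]

/-- A smooth image of a sphere avoids arbitrarily small vectors. -/
lemma exists_notMem_image_sphere {f : E → E} (hf : Differentiable ℝ f) {ε : ℝ} (hε : 0 < ε) :
    ∃ v, ‖v‖ < ε ∧ v ∉ f '' sphere 0 1 := by
  borelize E
  by_contra! h
  have h0 : Measure.addHaar (f '' sphere 0 1) = 0 :=
    addHaar_image_eq_zero_of_differentiableOn_of_addHaar_eq_zero _ hf.differentiableOn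
      (Measure.addHaar_sphere_of_ne_zero _ _ one_ne_zero)
  have := measure_mono_null
    (show ball (0 : E) ε ⊆ _ from fun v hv => h v (mem_ball_zero_iff.1 hv)) h0
  exact (measure_ball_pos Measure.addHaar (0 : E) hε).ne' this

/-- Nonvanishing maps from a closed subset of the unit sphere of `E` to `E` extend to nonvanishing
maps on the sphere. -/
lemma exists_extension_sphere_ne_zero {A : Set (sphere (0 : E) 1)} (hA : IsClosed A)
    {f : sphere (0 : E) 1 → E} (hf : ContinuousOn f A) (hf0 : ∀ x ∈ A, f x ≠ 0) :
    ∃ F : sphere (0 : E) 1 → E, Continuous F ∧ (∀ x ∈ A, F x = f x) ∧ ∀ x, F x ≠ 0 := by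
  obtain ⟨c, hc, hcf⟩ := hA.isCompact.exists_forall_le' (a := 0) hf.norm
    fun x hx => norm_pos_iff.2 (hf0 x hx)
  have he : Topology.IsClosedEmbedding fun x : A => (x.1 : E) :=
    isClosed_sphere.isClosedEmbedding_subtypeVal.comp hA.isClosedEmbedding_subtypeVal
  obtain ⟨F₀, hF₀⟩ := ContinuousMap.exists_extension' he ⟨A.domRestrict f, hf.domRestrict⟩
  have hF₀A : ∀ x ∈ A, F₀ x = f x := fun x hx => congr_fun hF₀ ⟨x, hx⟩
  obtain ⟨F₁, hF₁, hdist, -⟩ := F₀.continuous.exists_contDiff_approx 1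
    (continuous_const (y := c / 8)) fun _ => by positivity
  obtain ⟨v, hv, hvF⟩ := exists_notMem_image_sphere (hF₁.differentiable (by simp))
    (show 0 < c / 8 by positivity)
  set d : E → E := fun x => F₁ x - v - F₀ x with hd
  have hdn : ∀ x, ‖d x‖ < c / 4 := fun x => by
    have h1 := hdist x
    rw [dist_eq_norm] at h1
    have h2 : d x = (F₁ x - F₀ x) - v := by simp only [hd]; abel
    have := norm_sub_le (F₁ x - F₀ x) v
    rw [h2]
    linarith
  set ρ : E → ℝ := fun x => max 0 (min 1 (2 * (c - ‖F₀ x‖) / c)) with hρ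
  have hF₀c := F₀.continuous
  have hF₁c := hF₁.continuous
  have hρc : Continuous ρ := by fun_prop
  refine ⟨fun x => F₀ x + ρ x • d x, ?_, fun x hx => ?_, fun x => ?_⟩
  · have : Continuous fun x : E => F₀ x + ρ x • d x := by fun_prop
    exact this.comp continuous_subtype_val
  · have hle : 2 * (c - ‖F₀ x‖) / c ≤ 0 := by
      refine div_nonpos_of_nonpos_of_nonneg ?_ hc.le
      have := hcf x hx
      rw [hF₀A x hx]
      linarith
    have : ρ x = 0 := max_eq_left ((min_le_right _ _).trans hle)
    simp only [this, zero_smul, add_zero, hF₀A x hx]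
  · rcases le_total ‖F₀ x‖ (c / 2) with h | h
    · have hge : 1 ≤ 2 * (c - ‖F₀ x‖) / c := by
        rw [le_div_iff₀ hc]
        linarith
      have : ρ x = 1 := by simp only [hρ, min_eq_left hge]; simp
      intro h0
      refine hvF ⟨x, x.2, ?_⟩
      simp only [this, one_smul, hd, add_sub_cancel] at h0
      exact sub_eq_zero.1 h0
    · intro h0
      have h1 : ‖F₀ x‖ = ρ x * ‖d x‖ := by
        rw [eq_neg_of_add_eq_zero_left h0, norm_neg, norm_smul, Real.norm_of_nonneg]
        exact le_max_left _ _
      have h2 : ρ x ≤ 1 := max_le zero_le_one (min_le_left _ _)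
      have h3 := hdn x
      have h4 := mul_le_of_le_one_left (norm_nonneg (d x)) h2
      linarith

lemma exists_extension_sphere_ne_zero_of_finrank_eq {V : Type*} [NormedAddCommGroup V]
    [NormedSpace ℝ V] [FiniteDimensional ℝ V] (hV : Module.finrank ℝ V = Module.finrank ℝ E)
    {A : Set (sphere (0 : E) 1)} (hA : IsClosed A)
    {f : sphere (0 : E) 1 → V} (hf : ContinuousOn f A) (hf0 : ∀ x ∈ A, f x ≠ 0) :
    ∃ F : sphere (0 : E) 1 → V, Continuous F ∧ (∀ x ∈ A, F x = f x) ∧ ∀ x, F x ≠ 0 := by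
  let e : V ≃L[ℝ] E := ContinuousLinearEquiv.ofFinrankEq hV
  obtain ⟨F, hF, hFA, hF0⟩ := exists_extension_sphere_ne_zero hA
    (e.continuous.comp_continuousOn hf) fun x hx => by simpa using hf0 x hx
  exact ⟨fun x => e.symm (F x), e.symm.continuous.comp hF,
    fun x hx => by simp [hFA x hx], fun x => by simpa using hF0 x⟩

end Extension

namespace ListChain

open Metric Topology

section Equivariant

variable {G X : Type*} [Group G] [MulAction G X] [MetricSpace X] {q : ℕ} [NeZero q] {g : G}

omit [NeZero q] in
/-- A closed ball disjoint from its proper translates. -/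
lemma exists_closedBall_disjoint (hc : ∀ γ : G, Continuous fun x : X => γ • x)
    (hfree : ∀ i ∈ Finset.Ioo 0 q, ∀ x : X, g ^ i • x ≠ x) (x : X) :
    ∃ ε > 0, ∀ i ∈ Finset.Ioo 0 q, ∀ y ∈ closedBall x ε, g ^ i • y ∉ closedBall x ε := by
  have h : ∀ᶠ p : X × X in 𝓝 (x, x), ∀ i ∈ Finset.Ioo 0 q, g ^ i • p.1 ≠ p.2 := by
    rw [Filter.eventually_all_finset]
    intro i hi
    exact (isOpen_ne_fun ((hc (g ^ i)).comp continuous_fst) continuous_snd).mem_nhds (hfree i hi x)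
  rw [nhds_prod_eq, (nhds_basis_closedBall.prod_self).eventually_iff] at h
  obtain ⟨ε, hε, h⟩ := h
  exact ⟨ε, hε, fun i hi y hy hy' => h (Set.mk_mem_prod hy hy') i hi rfl⟩

variable [CompactSpace X] {V : Type*} [NormedAddCommGroup V] [NormedSpace ℂ V]

/-- The sum over `i < q` of the translates of a map by `g ^ i`, twisted by a character. -/
noncomputable def twistedSum (g : G) (q : ℕ) (φ : X → V) (x : X) : V :=
  ∑ i ∈ Finset.range q, zeta q ^ i • φ ((g ^ i)⁻¹ • x)

omit [MetricSpace X] [CompactSpace X] in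
lemma twistedSum_smul (hg : g ^ q = 1) (φ : X → V) (x : X) :
    twistedSum g q φ (g • x) = zeta q • twistedSum g q φ x := by
  obtain ⟨n, rfl⟩ := Nat.exists_eq_succ_of_ne_zero (NeZero.ne q)
  rw [twistedSum, twistedSum, Finset.sum_range_succ', Finset.sum_range_succ, smul_add,
    Finset.smul_sum]
  congr 1
  · refine Finset.sum_congr rfl fun i _ => ?_
    rw [smul_smul (zeta _), ← pow_succ', ← mul_smul, pow_succ' g, mul_inv_rev, inv_mul_cancel_right]
  · rw [smul_smul (zeta _), ← pow_succ', zeta_pow_self, ← mul_smul, pow_zero, pow_zero, inv_one,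
      one_mul, inv_eq_of_mul_eq_one_right (a := g ^ n) (b := g) (by rw [← pow_succ]; exact hg)]

omit [CompactSpace X] in
/-- Extend the region on which an equivariant map is nonzero by the translates of a set that is
disjoint from its proper translates. -/
lemma exists_equivariant_extension (hc : ∀ γ : G, Continuous fun x : X => γ • x)
    (hext : ∀ (A : Set X) (f : X → V), IsClosed A → ContinuousOn f A → (∀ x ∈ A, f x ≠ 0) →
      ∃ F : X → V, Continuous F ∧ (∀ x ∈ A, F x = f x) ∧ ∀ x, F x ≠ 0)
    (hg : g ^ q = 1) (hq : 1 < q) {A B : Set X} (hA : IsClosed A)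
    (hAg : ∀ i : ℕ, ∀ x ∈ A, g ^ i • x ∈ A) (hB : IsClosed B) (hBne : B.Nonempty)
    (hBg : ∀ i ∈ Finset.Ioo 0 q, ∀ y ∈ B, g ^ i • y ∉ B)
    {f : X → V} (hf : Continuous f) (hf0 : ∀ x ∈ A, f x ≠ 0)
    (hfg : ∀ x, f (g • x) = zeta q • f x) :
    ∃ F : X → V, Continuous F ∧ (∀ x ∈ A ∪ B, F x ≠ 0) ∧ ∀ x, F (g • x) = zeta q • F x := by
  obtain ⟨F, hF, hFA, hF0⟩ := hext A f hA hf.continuousOn hf0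
  set C : Set X := ⋃ i ∈ Finset.Ioo 0 q, (fun x => g ^ i • x) ⁻¹' B with hC
  have hCc : IsClosed C :=
    Set.Finite.isClosed_biUnion (Finset.finite_toSet _) fun i _ => hB.preimage (hc _)
  have hinv : ∀ i < q, (g ^ i)⁻¹ = g ^ (q - i) := fun i hi => by
    rw [inv_eq_iff_mul_eq_one, ← pow_add, Nat.add_sub_cancel' hi.le, hg]
  have hCne : C.Nonempty := by
    obtain ⟨b, hb⟩ := hBne
    refine ⟨(g ^ 1)⁻¹ • b, Set.mem_biUnion (x := 1) (by simpa using hq) ?_⟩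
    simpa using hb
  have hBC : ∀ x ∈ B, x ∉ C := fun x hx hxC => by
    simp only [hC, Set.mem_iUnion] at hxC
    obtain ⟨i, hi, hxi⟩ := hxC
    exact hBg i hi x hx hxi
  have hBC' : ∀ x ∈ B, ∀ i ∈ Finset.Ioo 0 q, (g ^ i)⁻¹ • x ∈ C := fun x hx i hi =>
    Set.mem_biUnion hi (by simpa using hx)
  have hpos : ∀ x ∉ C, 0 < infDist x C := fun x hx => (hCc.notMem_iff_infDist_pos hCne).1 hx
  set φ : X → V := fun x => (infDist x C : ℂ) • F x with hφ
  have hφc : Continuous φ :=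
    (Complex.continuous_ofReal.comp (continuous_infDist_pt C)).smul hF
  refine ⟨twistedSum g q φ, ?_, ?_, twistedSum_smul hg φ⟩
  · exact continuous_finsetSum _ fun i _ => (hφc.comp (hc _)).const_smul _
  · rintro x (hx | hx)
    · have hfi : ∀ i : ℕ, ∀ y, f (g ^ i • y) = zeta q ^ i • f y := by
        intro i y
        induction i with
        | zero => simp
        | succ i ih => rw [pow_succ', mul_smul, hfg, ih, smul_smul, pow_succ']
      have heq : twistedSum g q φ x =
          ((∑ i ∈ Finset.range q, infDist ((g ^ i)⁻¹ • x) C : ℝ) : ℂ) • f x := by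
        rw [twistedSum, Complex.ofReal_sum, Finset.sum_smul]
        refine Finset.sum_congr rfl fun i hi => ?_
        have hmem : (g ^ i)⁻¹ • x ∈ A := by
          rw [hinv i (Finset.mem_range.1 hi)]
          exact hAg _ x hx
        rw [hφ, smul_comm, hFA _ hmem, ← hfi, smul_inv_smul]
      rw [heq]
      refine smul_ne_zero (Complex.ofReal_ne_zero.2 ?_) (hf0 x hx)
      refine (Finset.sum_pos' (fun i _ => infDist_nonneg) ?_).ne'
      by_cases hxC : x ∈ C
      · simp only [hC, Set.mem_iUnion] at hxC
        obtain ⟨i, hi, hxi⟩ := hxC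
        obtain ⟨hi0, hiq⟩ := Finset.mem_Ioo.1 hi
        refine ⟨q - i, Finset.mem_range.2 (by omega), hpos _ (hBC _ ?_)⟩
        rw [hinv (q - i) (by omega), Nat.sub_sub_self hiq.le]
        exact hxi
      · exact ⟨0, Finset.mem_range.2 (by omega), hpos _ (by simpa using hxC)⟩
    · have heq : twistedSum g q φ x = φ x := by
        rw [twistedSum, Finset.sum_eq_single_of_mem 0 (Finset.mem_range.2 (by omega))]
        · simp
        · intro i hi hi0
          have := infDist_zero_of_mem (hBC' x hx i (Finset.mem_Ioo.2
            ⟨Nat.pos_of_ne_zero hi0, Finset.mem_range.1 hi⟩))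
          simp [hφ, this]
      rw [heq]
      exact smul_ne_zero (Complex.ofReal_ne_zero.2 (hpos x (hBC x hx)).ne') (hF0 x)

/-- A free cyclic action admits a nonvanishing equivariant map to a complex vector space for which
nonvanishing maps extend from closed sets. -/
theorem exists_equivariant_ne_zero (hc : ∀ γ : G, Continuous fun x : X => γ • x)
    (hext : ∀ (A : Set X) (f : X → V), IsClosed A → ContinuousOn f A → (∀ x ∈ A, f x ≠ 0) →
      ∃ F : X → V, Continuous F ∧ (∀ x ∈ A, F x = f x) ∧ ∀ x, F x ≠ 0)
    (hg : g ^ q = 1) (hq : 1 < q) (hfree : ∀ i ∈ Finset.Ioo 0 q, ∀ x : X, g ^ i • x ≠ x) :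
    ∃ f : X → V, Continuous f ∧ (∀ x, f x ≠ 0) ∧ ∀ x, f (g • x) = zeta q • f x := by
  choose ε hε hdisj using exists_closedBall_disjoint hc hfree
  obtain ⟨T, hT⟩ := CompactSpace.elim_nhds_subcover (fun x => closedBall x (ε x))
    fun x => closedBall_mem_nhds x (hε x)
  have key : ∀ T : Finset X, ∃ f : X → V, Continuous f ∧
      (∀ x ∈ ⋃ t ∈ T, closedBall t (ε t), f x ≠ 0) ∧ ∀ x, f (g • x) = zeta q • f x := by
    classical
    intro T
    induction T using Finset.induction_on with
    | empty => exact ⟨0, continuous_const, by simp, by simp⟩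
    | insert t T ht ih =>
      obtain ⟨f, hf, hf0, hfg⟩ := ih
      have hK : IsClosed (⋃ t ∈ T, closedBall t (ε t)) :=
        Set.Finite.isClosed_biUnion (Finset.finite_toSet _) fun _ _ => isClosed_closedBall
      obtain ⟨r, hr, hrf⟩ := hK.isCompact.exists_forall_le' (a := 0) hf.norm.continuousOn
        fun x hx => norm_pos_iff.2 (hf0 x hx)
      have hAg : ∀ i : ℕ, ∀ x ∈ {x | r ≤ ‖f x‖}, g ^ i • x ∈ {x | r ≤ ‖f x‖} := by
        intro i x hx
        induction i with
        | zero => simpa using hx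
        | succ i ih =>
          rw [pow_succ', mul_smul]
          simpa [hfg, norm_smul, norm_zeta] using ih
      obtain ⟨F, hF, hF0, hFg⟩ := exists_equivariant_extension hc hext hg hq
        (A := {x | r ≤ ‖f x‖}) (isClosed_le continuous_const hf.norm) hAg
        isClosed_closedBall ⟨t, mem_closedBall_self (hε t).le⟩ (hdisj t) hf
        (fun x hx => norm_pos_iff.1 (hr.trans_le hx)) hfg
      refine ⟨F, hF, fun x hx => hF0 x ?_, hFg⟩
      rw [Finset.set_biUnion_insert] at hx
      exact hx.symm.imp_left (hrf x)
  obtain ⟨f, hf, hf0, hfg⟩ := key T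
  exact ⟨f, hf, fun x => hf0 x (by rw [hT]; trivial), hfg⟩

end Equivariant

end ListChain

section Metacyclic

/-- Generators of a nonabelian semidirect product of cyclic groups of prime order. -/
lemma exists_metacyclic_generators {p q : ℕ} (hp : p.Prime) (hq : q.Prime) (hpodd : Odd p)
    {β : Multiplicative (ZMod p) →* MulAut (Multiplicative (ZMod q))} (hβ : β ≠ 1) :
    ∃ (g h : Multiplicative (ZMod q) ⋊[β] Multiplicative (ZMod p)) (r : ℕ), g ^ q = 1 ∧ g ≠ 1 ∧
      h ^ p = 1 ∧ h * g = g ^ r * h ∧ r.Coprime q ∧ (r : ZMod q) ^ 4 ≠ 1 := by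
  have : Fact q.Prime := ⟨hq⟩
  have : Fact p.Prime := ⟨hp⟩
  obtain ⟨a, ha⟩ : ∃ a, β a ≠ 1 := by
    by_contra! h
    exact hβ (MonoidHom.ext h)
  have hpow : ∀ x : Multiplicative (ZMod q), x = ofAdd 1 ^ (toAdd x).val := fun x => by
    rw [← ofAdd_nsmul, nsmul_one, ZMod.natCast_zmod_val, ofAdd_toAdd]
  obtain ⟨u, hu⟩ : ∃ u : ZMod q, β a (ofAdd 1) = ofAdd u := ⟨_, (ofAdd_toAdd _).symm⟩
  have hmul : ∀ x, β a x = ofAdd (u * toAdd x) := fun x => by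
    conv_lhs => rw [hpow x, map_pow, hu, ← ofAdd_nsmul]
    rw [nsmul_eq_mul, ZMod.natCast_zmod_val, mul_comm]
  have hap : a ^ p = 1 := by
    rw [← ofAdd_toAdd a, ← ofAdd_nsmul, nsmul_eq_mul, CharP.cast_eq_zero, zero_mul, ofAdd_zero]
  have hiter : ∀ j : ℕ, (β a ^ j) (ofAdd 1) = ofAdd (u ^ j) := fun j => by
    induction j with
    | zero => simp
    | succ j ih => rw [pow_succ', MulAut.mul_apply, ih, hmul, toAdd_ofAdd, ← pow_succ']
  have hup : u ^ p = 1 := by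
    have := hiter p
    rw [← map_pow, hap, map_one, MulAut.one_apply] at this
    exact (ofAdd.injective this).symm
  have hu1 : u ≠ 1 := by
    rintro rfl
    exact ha (MulEquiv.ext fun x => by rw [hmul, one_mul]; rfl)
  refine ⟨SemidirectProduct.inl (ofAdd 1), SemidirectProduct.inr a, u.val, ?_, ?_, ?_, ?_, ?_, ?_⟩
  · rw [← map_pow, ← ofAdd_nsmul, nsmul_one, CharP.cast_eq_zero, ofAdd_zero, map_one]
  · rw [Ne, ← map_one SemidirectProduct.inl, SemidirectProduct.inl_injective.eq_iff, ofAdd_eq_one]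
    exact one_ne_zero
  · rw [← map_pow, hap, map_one]
  · rw [← map_pow, ← ofAdd_nsmul, nsmul_one, ZMod.natCast_zmod_val, ← hu,
      SemidirectProduct.inl_aut]
    simp [mul_assoc]
  · exact ZMod.val_coe_unit_coprime (IsUnit.of_pow_eq_one hup hp.ne_zero).unit
  · rw [ZMod.natCast_zmod_val]
    intro h4
    have hcop : p.gcd 4 = 1 := (Nat.Coprime.pow_right 2 hpodd.coprime_two_right : p.Coprime (2 ^ 2))
    have : u ^ p.gcd 4 = 1 := pow_gcd_eq_one.2 ⟨hup, h4⟩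
    rw [hcop, pow_one] at this
    exact hu1 this

end Metacyclic

/-- Let `p` and `q` be distinct odd primes and let `β : ZMod p → Aut(ZMod q)` be
a nontrivial group homomorphism. Let `Γ` be the (nonabelian) semidirect product
`(ZMod q) ⋊ (ZMod p)` with respect to `β`. Then `Γ` admits no free continuous action on the
7-sphere `S⁷ = {x ∈ ℝ⁸ : ‖x‖ = 1}`: any action of `Γ` by homeomorphisms on `S⁷` for which every
`g ≠ 1` acts without fixed points leads to a contradiction. -/
theorem no_free_action_of_metacyclic_group_on_seven_sphere
    (p q : ℕ) (hp : p.Prime) (hq : q.Prime) (hpodd : Odd p) (hqodd : Odd q) (hpq : p ≠ q)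
    (β : Multiplicative (ZMod p) →* MulAut (Multiplicative (ZMod q))) (hβ : β ≠ 1)
    [MulAction (Multiplicative (ZMod q) ⋊[β] Multiplicative (ZMod p))
      (Metric.sphere (0 : EuclideanSpace ℝ (Fin 8)) 1)]
    (hcont : ∀ g : Multiplicative (ZMod q) ⋊[β] Multiplicative (ZMod p),
      Continuous fun x : Metric.sphere (0 : EuclideanSpace ℝ (Fin 8)) 1 => g • x)
    (hfree : ∀ (g : Multiplicative (ZMod q) ⋊[β] Multiplicative (ZMod p))
      (x : Metric.sphere (0 : EuclideanSpace ℝ (Fin 8)) 1), g • x = x → g = 1) :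
    False := by
  have : Fact q.Prime := ⟨hq⟩
  have : NeZero p := ⟨hp.ne_zero⟩
  have : Finite (Multiplicative (ZMod q) ⋊[β] Multiplicative (ZMod p)) :=
    Finite.of_equiv _ SemidirectProduct.equivProd.symm
  obtain ⟨g, h, r, hg, hg1, hh, hgh, hr, hr4⟩ :=
    exists_metacyclic_generators (β := β) hp hq hpodd hβ
  have hunif := fun γ => CompactSpace.uniformContinuous_of_continuous (hcont γ)
  have hgi : ∀ i ∈ Finset.Ioo 0 q, ∀ x : Metric.sphere (0 : EuclideanSpace ℝ (Fin 8)) 1,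
      g ^ i • x ≠ x := by
    intro i hi x hx
    rw [Finset.mem_Ioo] at hi
    have := orderOf_dvd_of_pow_eq_one (hfree _ x hx)
    rw [orderOf_eq_prime hg hg1] at this
    exact absurd (Nat.le_of_dvd hi.1 this) (by omega)
  obtain ⟨f, hf, hf0, hfg⟩ := ListChain.exists_equivariant_ne_zero (V := Fin 4 → ℂ) hcont
    (fun A f hA hf hf0 => exists_extension_sphere_ne_zero_of_finrank_eq
      (by simp [Module.finrank_pi_fintype, Complex.finrank_real_complex]) hA hf hf0)
    hg hq.one_lt hgi
  obtain ⟨U, hU, haug⟩ :=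
    ListChain.exists_entourage_augmentation_eq_zero hunif hg hqodd hf hf0 hfg
  obtain ⟨hA, hdeg⟩ := ListChain.acyclicBelow_and_hasDegree_sphere (n := 8) (by norm_num)
  obtain ⟨c, hc, hc0⟩ :=
    ListChain.exists_isResolution_eight hunif hA hdeg hpodd hq hqodd hg hh hgh hr hr4 hU
  have := haug c (by simpa using hc)
  rw [ListChain.augmentation_apply, hc0] at this
  simp at this
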